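/- Let C : f = 0 be a reduced plane curve of odd degree d which is not free, i.e. N(f) ≠ 0, and set T = 3(d−2). Then dim_ℂ N(f)_{⌊T/2⌋} = 1 if and only if dim_ℂ N(f)_k ≤ 1 for all k. Moreover, dim_ℂ N(f) ≥ 2, and the minimal value dim_ℂ N(f) = 2 is attained if and only if dim_ℂ N(f)_{⌊T/2⌋} = 1 and dim_ℂ N(f)_{⌊T/2⌋ − 1} = 0. -/

import Mathlib

open MvPolynomial

noncomputable section

/-- The polynomial ring `S = ℂ[x,y,z]`. -/
abbrev S : Type := MvPolynomial (Fin 3) ℂ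

/-- The Jacobian ideal of `f`, spanned by the three partial derivatives. -/
def Jf (f : S) : Ideal S := Ideal.span {pderiv 0 f, pderiv 1 f, pderiv 2 f}

/-- The irrelevant maximal ideal `m = (x,y,z)`. -/
def mId : Ideal S := Ideal.span {X 0, X 1, X 2}

/-- The saturation `I_f` of the Jacobian ideal with respect to `m`. -/
def Isat (f : S) : Ideal S := ⨆ n : ℕ, Submodule.colon (Jf f) ((mId ^ n : Ideal S) : Submodule S S)

/-- The quotient map `S → M(f) = S/J_f`, as a `ℂ`-linear map. -/
def quotC (f : S) : S →ₗ[ℂ] (S ⧸ (Jf f : Submodule S S)) :=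
  ((Jf f : Submodule S S).mkQ).restrictScalars ℂ

/-- Degree-`k` homogeneous component of `S`, as a `ℂ`-subspace. -/
def Sgr (k : ℕ) : Submodule ℂ S := homogeneousSubmodule (Fin 3) ℂ k

/-- The degree-`k` part of the Milnor algebra `M(f)`. -/
def Msub (f : S) (k : ℕ) : Submodule ℂ (S ⧸ (Jf f : Submodule S S)) := (Sgr k).map (quotC f)

/-- `m(f)_k`, the dimension of the degree-`k` part of the Milnor algebra. -/
def mdim (f : S) (k : ℕ) : ℕ := Module.finrank ℂ (Msub f k)

/-- The degree-`k` part of the Jacobian module `N(f) = I_f/J_f`, realized inside `S/J_f`. -/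
def Nsub (f : S) (k : ℕ) : Submodule ℂ (S ⧸ (Jf f : Submodule S S)) :=
  (((Isat f).restrictScalars ℂ) ⊓ Sgr k).map (quotC f)

/-- `dim_ℂ N(f)_k`. -/
def ndim (f : S) (k : ℕ) : ℕ := Module.finrank ℂ (Nsub f k)

/-- The Jacobian module `N(f) = I_f/J_f`, as an `S`-submodule of `S/J_f`. -/
def Nmod (f : S) : Submodule S (S ⧸ (Jf f : Submodule S S)) :=
  Submodule.map ((Jf f : Submodule S S).mkQ) (Isat f : Submodule S S)

/-- The Jacobian module `N(f)` as a `ℂ`-subspace of `S/J_f`. -/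
def NsubTot (f : S) : Submodule ℂ (S ⧸ (Jf f : Submodule S S)) :=
  ((Isat f).restrictScalars ℂ).map (quotC f)

/-- `dim_ℂ N(f)`. -/
def ndimTot (f : S) : ℕ := Module.finrank ℂ (NsubTot f)

/-- `C : f = 0` is nearly free: `N(f) ≠ 0` and `dim N(f)_k ≤ 1` for all `k`. -/
def NearlyFree (f : S) : Prop := Nmod f ≠ ⊥ ∧ ∀ k : ℕ, ndim f k ≤ 1

/-- `f` defines a union of lines passing through one point. -/
def IsConeOfLines (f : S) : Prop :=
  ∃ q : Fin 3 → ℂ, q ≠ 0 ∧ ∃ (c : ℂ) (L : Multiset S),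
    (∀ l ∈ L, l ∈ Sgr 1 ∧ eval q l = 0) ∧ f = C c * L.prod

/-- The defining equation map `(a,b,c) ↦ a f_x + b f_y + c f_z`. -/
def eqnMap (f : S) : (Fin 3 → S) →ₗ[S] S where
  toFun r := ∑ i, r i * pderiv i f
  map_add' a b := by simp [add_mul, Finset.sum_add_distrib]
  map_smul' c a := by simp [Finset.mul_sum, mul_assoc]

/-- `AR(f)`, the module of all relations among the partial derivatives of `f`. -/
def ARmod (f : S) : Submodule S (Fin 3 → S) := LinearMap.ker (eqnMap f)

/-- A triple of polynomials is homogeneous of degree `m` (componentwise). -/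
def IsHomRel (r : Fin 3 → S) (m : ℕ) : Prop := ∀ i, r i ∈ Sgr m

/-- The set of degrees of nonzero homogeneous relations in `AR(f)`;
its least element is `mdr(f)`. -/
def mdrSet (f : S) : Set ℕ := {m | ∃ r ∈ ARmod f, r ≠ 0 ∧ IsHomRel r m}

/-- The map `(u₁,u₂,u₃) ↦ u₁ r₁ + u₂ r₂ + u₃ r₃` whose kernel is the syzygy
module among `r₁, r₂, r₃`. -/
def syzMap (r : Fin 3 → (Fin 3 → S)) : (Fin 3 → S) →ₗ[S] (Fin 3 → S) where
  toFun u := ∑ j, u j • r j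
  map_add' a b := by simp [add_smul, Finset.sum_add_distrib]
  map_smul' c a := by simp [Finset.smul_sum, smul_smul]

/-- `M(f)` has a minimal graded free resolution
`0 → S(−b−2(d−1)) → ⊕ᵢ S(−dᵢ−(d−1)) → S(−d+1)³ → S`; equivalently, `AR(f)` is
generated by three homogeneous relations of degrees `d₁, d₂, d₃`, none lying in
the submodule spanned by the other two, whose syzygy module is free of rank one,
generated by a homogeneous triple `(v₁,v₂,v₃)` with `deg vᵢ = b − dᵢ + d − 1`. -/
def HasResolution (f : S) (d : ℕ) (dd : Fin 3 → ℕ) (b : ℤ) : Prop :=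
  ∃ r : Fin 3 → (Fin 3 → S),
    (∀ j, r j ∈ ARmod f) ∧
    (∀ j, IsHomRel (r j) (dd j)) ∧
    Submodule.span S (Set.range r) = ARmod f ∧
    (∀ j, r j ∉ Submodule.span S (r '' {k | k ≠ j})) ∧
    ∃ v : Fin 3 → S, v ≠ 0 ∧
      (∀ j, ∃ e : ℕ, (e : ℤ) = b - dd j + d - 1 ∧ v j ∈ Sgr e) ∧
      LinearMap.ker (syzMap r) = Submodule.span S {v}

/-- The Hilbert function of the Milnor algebra of a smooth plane curve of
degree `d`: the coefficient of `t^k` in `((1 − t^{d−1})/(1 − t))³`. -/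
def msHilb (d k : ℕ) : ℕ :=
  (((∑ i ∈ Finset.range (d - 1), (Polynomial.X : Polynomial ℕ) ^ i)) ^ 3).coeff k

/-- `τ` is the total Tjurina number of `C : f = 0`, i.e. the common value of
`m(f)_k` for all sufficiently large `k`. -/
def TjurinaIs (f : S) (τ : ℕ) : Prop := ∃ N : ℕ, ∀ k ≥ N, mdim f k = τ


theorem nf_hc_mul {σ : Type} (a g : MvPolynomial σ ℂ) (e j : ℕ) (hg : g.IsHomogeneous e) :
    homogeneousComponent j (a * g) = if e ≤ j then homogeneousComponent (j - e) a * g else 0 := by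
  conv_lhs => rw [← sum_homogeneousComponent a, Finset.sum_mul, map_sum]
  have h1 : ∀ i, homogeneousComponent j (homogeneousComponent i a * g)
      = if j = i + e then homogeneousComponent i a * g else 0 := by
    intro i
    rw [homogeneousComponent_of_mem
      (show homogeneousComponent i a * g ∈ homogeneousSubmodule σ ℂ (i + e) from
        (homogeneousComponent_isHomogeneous i a).mul hg)]
  simp only [h1]
  split_ifs with h
  · by_cases h2 : j - e < a.totalDegree + 1
    · rw [Finset.sum_eq_single (j - e)]
      · rw [if_pos (by omega)]
      · intro b _ hb; rw [if_neg (by omega)]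
      · intro hb; simp at hb; omega
    · rw [homogeneousComponent_eq_zero _ _ (by omega), zero_mul]
      apply Finset.sum_eq_zero
      intro i hi; simp at hi; rw [if_neg (by omega)]
  · apply Finset.sum_eq_zero
    intro i hi; rw [if_neg (by omega)]

theorem nf_mem_span_hom {σ ι : Type} [Fintype ι] (F : ι → MvPolynomial σ ℂ) (e j : ℕ)
    (hF : ∀ i, (F i).IsHomogeneous e) (u : MvPolynomial σ ℂ) (hu : u ∈ Ideal.span (Set.range F)) :
    ∃ a : ι → MvPolynomial σ ℂ, homogeneousComponent j u = ∑ i, a i * F i ∧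
      (e ≤ j → ∀ i, (a i).IsHomogeneous (j - e)) ∧ (j < e → ∀ i, a i = 0) := by
  obtain ⟨b, rfl⟩ := (Ideal.mem_span_range_iff_exists_fun).1 hu
  refine ⟨fun i => if e ≤ j then homogeneousComponent (j - e) (b i) else 0, ?_, ?_, ?_⟩
  · rw [map_sum]
    refine Finset.sum_congr rfl fun i _ => ?_
    rw [nf_hc_mul _ _ _ _ (hF i)]; split_ifs <;> simp
  · intro h i; simp only [h, if_true]; exact homogeneousComponent_isHomogeneous _ _
  · intro h i; simp [Nat.not_le.2 h]

theorem nf_span_hc {σ ι : Type} [Fintype ι] (F : ι → MvPolynomial σ ℂ) (e j : ℕ)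
    (hF : ∀ i, (F i).IsHomogeneous e) (u : MvPolynomial σ ℂ) (hu : u ∈ Ideal.span (Set.range F)) :
    homogeneousComponent j u ∈ Ideal.span (Set.range F) := by
  obtain ⟨a, h, -⟩ := nf_mem_span_hom F e j hF u hu
  rw [h]
  exact (Ideal.mem_span_range_iff_exists_fun).2 ⟨a, rfl⟩

theorem nf_const_of_pderiv {σ : Type} [Fintype σ] (p : MvPolynomial σ ℂ) (h : ∀ i, pderiv i p = 0) :
    ∃ c, p = C c := by
  classical
  refine ⟨coeff 0 p, ?_⟩
  ext m
  rw [coeff_C]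
  split_ifs with hm
  · rw [hm]
  · have : ∃ i, m i ≠ 0 := by
      by_contra hh; push Not at hh; exact hm (by ext i; simp [hh i])
    obtain ⟨i, hi⟩ := this
    have h1 := congrArg (coeff (m - Finsupp.single i 1)) (h i)
    rw [coeff_pderiv, coeff_zero] at h1
    have h2 : m - Finsupp.single i 1 + Finsupp.single i 1 = m := by
      ext k; by_cases hk : i = k
      · subst hk; simp; omega
      · simp [hk]
    rw [h2] at h1
    rcases mul_eq_zero.1 h1 with h3 | h3
    · exact h3
    · exfalso; norm_cast at h3

theorem nf_totalDegree_pderiv_lt {σ : Type} (p : MvPolynomial σ ℂ) (i : σ) (h : pderiv i p ≠ 0) :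
    (pderiv i p).totalDegree < p.totalDegree := by
  classical
  obtain ⟨m, hm, hm'⟩ := Finset.exists_mem_eq_sup (pderiv i p).support
    (by simpa using h) (fun m => m.sum fun _ e => e)
  have h3 : m + Finsupp.single i 1 ∈ p.support := by
    rw [mem_support_iff, coeff_pderiv] at hm
    rw [mem_support_iff]; exact left_ne_zero_of_mul hm
  have h4 := le_totalDegree h3
  rw [totalDegree, hm']
  rw [Finsupp.sum_add_index' (by simp) (by simp)] at h4
  simp at h4 ⊢
  exact h4

theorem nf_reduced_coprime (f : S) (d : ℕ) (hd : d ≠ 0) (hhom : f.IsHomogeneous d)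
    (hred : Squarefree f) (p : S) (hp : Prime p) (h : ∀ i, p ∣ pderiv i f) : False := by
  have hf : p ∣ f := by
    have h1 := hhom.sum_X_mul_pderiv
    have h2 : p ∣ d • f := by
      rw [← h1]; exact Finset.dvd_sum fun i _ => (h i).mul_left _
    have h3 : f = C ((d:ℂ)⁻¹) * (d • f) := by
      rw [nsmul_eq_mul, ← mul_assoc, ← C_eq_coe_nat, ← C_mul, inv_mul_cancel₀ (by exact_mod_cast hd)]
      simp
    rw [h3]; exact h2.mul_left _
  obtain ⟨g, rfl⟩ := hf
  have hpg : ¬ p ∣ g := by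
    rintro ⟨q, rfl⟩
    exact hp.not_isUnit (hred p ⟨q, by ring⟩)
  have hd0 : ∀ i, pderiv i p = 0 := by
    intro i
    by_contra hne
    have h1 := h i
    rw [pderiv_mul] at h1
    have h2 : p ∣ pderiv i p * g := (dvd_add_left (dvd_mul_right _ _)).1 h1
    have h3 := (hp.dvd_or_dvd h2).resolve_right hpg
    have := totalDegree_le_of_dvd_of_isDomain h3 hne
    have := nf_totalDegree_pderiv_lt p i hne
    omega
  obtain ⟨c, rfl⟩ := nf_const_of_pderiv p hd0
  have hc : c ≠ 0 := by rintro rfl; exact hp.ne_zero (by simp)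
  exact hp.not_isUnit ((isUnit_iff_ne_zero.2 hc).map C)

theorem nf_combo (a b c : S) (ha : a ≠ 0)
    (hno : ∀ p, Prime p → p ∣ a → p ∣ b → p ∣ c → False) :
    ∃ t : ℂ, IsRelPrime a (b + C t * c) := by
  classical
  let bad : Set ℂ := ⋃ p ∈ (UniqueFactorizationMonoid.factors a).toFinset, {t | p ∣ b + C t * c}
  have hfin : bad.Finite := by
    refine Set.Finite.biUnion (Finset.finite_toSet _) ?_
    intro p hp
    have hp' : p ∈ UniqueFactorizationMonoid.factors a := by simpa using hp
    have hpp := UniqueFactorizationMonoid.prime_of_factor p hp'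
    have hpa := UniqueFactorizationMonoid.dvd_of_mem_factors hp'
    apply Set.Subsingleton.finite
    intro t ht t' ht'
    by_contra hne
    have h1 : p ∣ C (t - t') * c := by
      have := dvd_sub ht ht'
      convert this using 1
      rw [C_sub]; ring
    have h2 : p ∣ c := by
      have : c = C ((t - t')⁻¹) * (C (t - t') * c) := by
        rw [← mul_assoc, ← C_mul, inv_mul_cancel₀ (sub_ne_zero.2 hne)]; simp
      rw [this]; exact h1.mul_left _
    have h3 : p ∣ b := (dvd_add_left (h2.mul_left _)).1 ht
    exact hno p hpp hpa h3 h2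
  obtain ⟨t, ht⟩ := hfin.exists_notMem
  refine ⟨t, WfDvdMonoid.isRelPrime_of_no_irreducible_factors (by tauto) ?_⟩
  intro p hp hpa hpb
  obtain ⟨q, hq, hpq⟩ := UniqueFactorizationMonoid.exists_mem_factors_of_dvd ha hp hpa
  apply ht
  simp only [bad, Set.mem_iUnion]
  exact ⟨q, by simpa using hq, hpq.symm.dvd.trans hpb⟩

theorem nf_span3 (a b c : S) (t : ℂ) :
    Ideal.span {a, b + C t * c, c} = Ideal.span {a, b, c} := by
  apply le_antisymm
  · rw [Ideal.span_le]
    rintro x (rfl | rfl | rfl)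
    · exact Ideal.subset_span (by simp)
    · exact Ideal.add_mem _ (Ideal.subset_span (by simp))
        (Ideal.mul_mem_left _ _ (Ideal.subset_span (by simp)))
    · exact Ideal.subset_span (by simp)
  · rw [Ideal.span_le]
    rintro x (rfl | rfl | rfl)
    · exact Ideal.subset_span (by simp)
    · have h1 : x + C t * c ∈ Ideal.span {a, x + C t * c, c} := Ideal.subset_span (by simp)
      have h2 : c ∈ Ideal.span {a, x + C t * c, c} := Ideal.subset_span (by simp)
      have := Ideal.sub_mem _ h1 (Ideal.mul_mem_left _ (C t) h2)
      simpa using this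
    · exact Ideal.subset_span (by simp)

theorem nf_combo3 (F : Fin 3 → S) (e : ℕ) (hF : ∀ i, (F i).IsHomogeneous e)
    (hno : ∀ p, Prime p → (∀ i, p ∣ F i) → False) :
    ∃ g1 g2 h : S, g1.IsHomogeneous e ∧ g2.IsHomogeneous e ∧ h.IsHomogeneous e ∧
      Ideal.span {F 0, F 1, F 2} = Ideal.span {g1, g2, h} ∧ g1 ≠ 0 ∧ IsRelPrime g1 g2 := by
  have key : ∀ a b c : S, a.IsHomogeneous e → b.IsHomogeneous e → c.IsHomogeneous e → a ≠ 0 →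
      (∀ p, Prime p → p ∣ a → p ∣ b → p ∣ c → False) →
      Ideal.span {F 0, F 1, F 2} = Ideal.span {a, b, c} →
      ∃ g1 g2 h : S, g1.IsHomogeneous e ∧ g2.IsHomogeneous e ∧ h.IsHomogeneous e ∧
      Ideal.span {F 0, F 1, F 2} = Ideal.span {g1, g2, h} ∧ g1 ≠ 0 ∧ IsRelPrime g1 g2 := by
    intro a b c ha hb hc ha0 hp hs
    obtain ⟨t, ht⟩ := nf_combo a b c ha0 hp
    exact ⟨a, b + C t * c, c, ha, hb.add (hc.C_mul t), hc, by rw [nf_span3, hs], ha0, ht⟩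
  by_cases h0 : F 0 = 0
  · by_cases h1 : F 1 = 0
    · by_cases h2 : F 2 = 0
      · exfalso
        refine hno (X 0) (MvPolynomial.X_prime) fun i => ?_
        fin_cases i <;> simp [h0, h1, h2]
      · refine key (F 2) (F 0) (F 1) (hF _) (hF _) (hF _) h2 (fun p hp a b c => hno p hp fun i => by
          fin_cases i <;> simpa) ?_
        congr 1; ext x; simp; tauto
    · refine key (F 1) (F 0) (F 2) (hF _) (hF _) (hF _) h1 (fun p hp a b c => hno p hp fun i => by
          fin_cases i <;> simpa) ?_
      congr 1; ext x; simp; tauto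
  · exact key (F 0) (F 1) (F 2) (hF _) (hF _) (hF _) h0 (fun p hp a b c => hno p hp fun i => by
          fin_cases i <;> simpa) rfl

/-- shift hom -/
def nfSh (O : Fin 3 → ℂ) : S →+* Polynomial S :=
  eval₂Hom (Polynomial.C.comp C) (fun i => Polynomial.C (X i) + Polynomial.C (C (O i)) * Polynomial.X)

theorem nfSh_relprime (O : Fin 3 → ℂ) (g1 g2 : S) (h0 : g1 ≠ 0) (h : IsRelPrime g1 g2) :
    IsRelPrime (nfSh O g1) (nfSh O g2) := by
  let A : (Fin 3 → ℂ) → (Polynomial S →+* Polynomial S) := fun O =>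
    Polynomial.eval₂RingHom (nfSh O) Polynomial.X
  have hA : ∀ O, (A (-O)).comp (A O) = RingHom.id _ := by
    intro O
    apply Polynomial.ringHom_ext
    · intro a
      have : ((A (-O)).comp (A O)).comp Polynomial.C = Polynomial.C := by
        apply MvPolynomial.ringHom_ext
        · intro r; simp [A, nfSh]
        · intro i; simp [A, nfSh]; ring
      exact DFunLike.congr_fun this a
    · simp [A]
  have hAC : ∀ g, A O (Polynomial.C g) = nfSh O g := fun g => by simp [A]
  have hinv : ∀ x, A (-O) (A O x) = x := fun x => DFunLike.congr_fun (hA O) x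
  have hinv' : ∀ x, A O (A (-O) x) = x := fun x => by
    have := DFunLike.congr_fun (hA (-O)) x
    simpa using this
  intro p hp1 hp2
  have k1 : A (-O) p ∣ Polynomial.C g1 := by
    have := map_dvd (A (-O)) hp1
    rwa [← hAC, hinv] at this
  have k2 : A (-O) p ∣ Polynomial.C g2 := by
    have := map_dvd (A (-O)) hp2
    rwa [← hAC, hinv] at this
  have hdeg : (A (-O) p).natDegree = 0 := by
    have := Polynomial.natDegree_le_of_dvd k1 (by simpa using h0)
    simpa using this
  obtain ⟨q, hq⟩ := Polynomial.natDegree_eq_zero.1 hdeg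
  rw [← hq] at k1 k2
  have k3 := (Polynomial.C_dvd_iff_dvd_coeff _ _).1 k1 0
  have k4 := (Polynomial.C_dvd_iff_dvd_coeff _ _).1 k2 0
  rw [Polynomial.coeff_C_zero] at k3 k4
  have hu := h k3 k4
  rw [← hinv' p, ← hq]
  exact (hu.map Polynomial.C).map (A O)

theorem nfSh_degree (O : Fin 3 → ℂ) (g : S) (e : ℕ) (hg : g.IsHomogeneous e) :
    (nfSh O g).natDegree ≤ e ∧ (nfSh O g).coeff e = C (eval O g) := by
  have hl : ∀ i, (Polynomial.C (X i : S) + Polynomial.C (C (O i)) * Polynomial.X).natDegree ≤ 1 := by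
    intro i; compute_degree
  have key : ∀ m ∈ g.support, ∀ c : ℂ, (nfSh O (monomial m c)).natDegree ≤ e ∧
      (nfSh O (monomial m c)).coeff e = C (eval O (monomial m c)) := by
    intro m hm c
    have he : m 0 + m 1 + m 2 = e := by
      have := hg (mem_support_iff.1 hm)
      rw [← this]
      simp [Finsupp.weight_apply, Finsupp.sum_fintype, Fin.sum_univ_three]
    have e1 : nfSh O (monomial m c) = Polynomial.C (C c) * ∏ i : Fin 3,
        (Polynomial.C (X i : S) + Polynomial.C (C (O i)) * Polynomial.X) ^ m i := by
      simp [nfSh, Finsupp.prod_fintype, eval₂_monomial]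
    have e2 : eval O (monomial m c) = c * ∏ i : Fin 3, O i ^ m i := by
      simp [eval_monomial, Finsupp.prod_fintype]
    have hp : ∀ i, ((Polynomial.C (X i : S) + Polynomial.C (C (O i)) * Polynomial.X) ^ m i).natDegree
        ≤ m i := by
      intro i
      refine (Polynomial.natDegree_pow_le_of_le (m i) (hl i)).trans (by simp)
    have hc : ∀ i, ((Polynomial.C (X i : S) + Polynomial.C (C (O i)) * Polynomial.X) ^ m i).coeff (m i)
        = C (O i) ^ m i := by
      intro i
      have := Polynomial.coeff_pow_of_natDegree_le (m := m i) (hl i)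
      simpa [Polynomial.coeff_C] using this
    rw [e1, e2]
    rw [Fin.prod_univ_three, Fin.prod_univ_three]
    have h01 := Polynomial.natDegree_mul_le_of_le (hp 0) (hp 1)
    constructor
    · refine (Polynomial.natDegree_C_mul_le _ _).trans ?_
      rw [← he]
      exact Polynomial.natDegree_mul_le_of_le h01 (hp 2)
    · rw [Polynomial.coeff_C_mul, ← he,
        Polynomial.coeff_mul_add_eq_of_natDegree_le h01 (hp 2),
        Polynomial.coeff_mul_add_eq_of_natDegree_le (hp 0) (hp 1), hc, hc, hc]
      simp
  constructor
  · conv_lhs => rw [g.as_sum, map_sum]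
    exact Polynomial.natDegree_sum_le_of_forall_le _ _ fun m hm => (key m hm _).1
  · conv_lhs => rw [g.as_sum, map_sum]
    rw [Polynomial.finsetSum_coeff]
    conv_rhs => rw [g.as_sum, map_sum, map_sum]
    exact Finset.sum_congr rfl fun m hm => (key m hm _).2

theorem nf_elim_aux (K : Type) [Field K] [Algebra S K] [IsFractionRing S K] (O : Fin 3 → ℂ) (g1 g2 : S) (e : ℕ) (hg1 : g1.IsHomogeneous e)
    (hO : eval O g1 ≠ 0) (h : IsRelPrime g1 g2) :
    ∃ (D : S) (a b : Polynomial S), D ≠ 0 ∧ a * nfSh O g1 + b * nfSh O g2 = Polynomial.C D := by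
  have h0 : g1 ≠ 0 := by rintro rfl; simp at hO
  have hrel := nfSh_relprime O g1 g2 h0 h
  obtain ⟨hd, hc⟩ := nfSh_degree O g1 e hg1
  set G1 := nfSh O g1
  set G2 := nfSh O g2
  let P : Polynomial S := Polynomial.C (C (eval O g1)⁻¹) * G1
  have hP : P.Monic := by
    apply Polynomial.monic_of_natDegree_le_of_coeff_eq_one e
    · exact (Polynomial.natDegree_C_mul_le _ _).trans hd
    · simp only [P]
      rw [Polynomial.coeff_C_mul, hc, ← C_mul, inv_mul_cancel₀ hO, C_1]
  have hunit : IsUnit (Polynomial.C (C (eval O g1)⁻¹ : S)) :=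
    ((isUnit_iff_ne_zero.2 (inv_ne_zero hO)).map C).map Polynomial.C
  let ι : Polynomial S →+* Polynomial K := Polynomial.mapRingHom (algebraMap S K)
  have hcop : IsCoprime (ι P) (ι G2) := by
    rw [← isRelPrime_iff_isCoprime]
    intro q hq1 hq2
    obtain ⟨q', hq'⟩ := IsIntegrallyClosed.eq_map_mul_C_of_dvd K hP hq1
    have hq0 : q ≠ 0 := by
      rintro rfl
      exact (hP.map (algebraMap S K)).ne_zero (zero_dvd_iff.1 hq1)
    have hlc : q.leadingCoeff ≠ 0 := by simpa using hq0
    have hu : IsUnit (Polynomial.C q.leadingCoeff) := (isUnit_iff_ne_zero.2 hlc).map Polynomial.C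
    have hm' : (q'.map (algebraMap S K)).Monic := by
      have := congrArg Polynomial.leadingCoeff hq'
      rw [Polynomial.leadingCoeff_mul, Polynomial.leadingCoeff_C] at this
      exact mul_right_cancel₀ hlc (by rw [this, one_mul])
    have hm : q'.Monic := Polynomial.monic_of_injective (IsFractionRing.injective S K) hm'
    have d1 : q' ∣ P := by
      rw [← Polynomial.map_dvd_map _ (IsFractionRing.injective S K) hm]
      exact (Dvd.intro _ hq').trans hq1
    have d2 : q' ∣ G2 := by
      rw [← Polynomial.map_dvd_map _ (IsFractionRing.injective S K) hm]
      exact (Dvd.intro _ hq').trans hq2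
    have d3 : q' ∣ G1 := (hunit.dvd_mul_left).1 d1
    rw [← hq']
    exact ((hrel d3 d2).map ι).mul hu
  obtain ⟨a, b, hab⟩ := hcop
  obtain ⟨c, hc0, hca⟩ := IsLocalization.integerNormalization_spec (nonZeroDivisors S) a
  obtain ⟨c', hc0', hcb⟩ := IsLocalization.integerNormalization_spec (nonZeroDivisors S) b
  set a' := IsLocalization.integerNormalization (nonZeroDivisors S) a
  set b' := IsLocalization.integerNormalization (nonZeroDivisors S) b
  refine ⟨c * c', Polynomial.C c' * a' * Polynomial.C (C (eval O g1)⁻¹), Polynomial.C c * b', ?_, ?_⟩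
  · exact mul_ne_zero (nonZeroDivisors.ne_zero hc0) (nonZeroDivisors.ne_zero hc0')
  · apply Polynomial.map_injective _ (IsFractionRing.injective S K)
    have h1 : ∀ (c : S) (x : Polynomial K), c • x = Polynomial.C (algebraMap S K c) * x := by
      intro c x
      rw [← Polynomial.smul_eq_C_mul, algebraMap_smul]
    have h2 : Polynomial.C c' * a' * Polynomial.C (C (eval O g1)⁻¹) * G1 = Polynomial.C c' * a' * P := by
      simp only [P]; ring
    rw [h2]
    simp only [Polynomial.map_add, Polynomial.map_mul, Polynomial.map_C, hca, hcb, h1, map_mul]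
    have h3 : a * P.map (algebraMap S K) + b * G2.map (algebraMap S K) = 1 := hab
    linear_combination (Polynomial.C (algebraMap S K c) * Polynomial.C (algebraMap S K c')) * h3

theorem nf_elim (O : Fin 3 → ℂ) (g1 g2 : S) (e : ℕ) (hg1 : g1.IsHomogeneous e)
    (hO : eval O g1 ≠ 0) (h : IsRelPrime g1 g2) :
    ∃ (D : S) (a b : Polynomial S), D ≠ 0 ∧ a * nfSh O g1 + b * nfSh O g2 = Polynomial.C D :=
  nf_elim_aux (FractionRing S) O g1 g2 e hg1 hO h

theorem nf_goodpts (g1 g2 : S) (e : ℕ) (he : e ≠ 0) (hg1 : g1.IsHomogeneous e)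
    (hg2 : g2.IsHomogeneous e) (h0 : g1 ≠ 0) (h : IsRelPrime g1 g2) :
    ∃ O Q : Fin 3 → ℂ, (∃ i j, O i * Q j - O j * Q i ≠ 0) ∧
      IsRelPrime (aeval (fun i => C (O i) * X 0 + C (Q i) * X 1 : Fin 3 → MvPolynomial (Fin 2) ℂ) g1)
        (aeval (fun i => C (O i) * X 0 + C (Q i) * X 1 : Fin 3 → MvPolynomial (Fin 2) ℂ) g2) := by
  obtain ⟨O, hO⟩ : ∃ O, eval O g1 ≠ 0 := by
    by_contra hh; push Not at hh
    exact h0 (MvPolynomial.funext fun x => by simpa using hh x)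
  obtain ⟨D, a, b, hD, hab⟩ := nf_elim O g1 g2 e hg1 hO h
  obtain ⟨Q, hQ⟩ : ∃ O, eval O D ≠ 0 := by
    by_contra hh; push Not at hh
    exact hD (MvPolynomial.funext fun x => by simpa using hh x)
  have hab' := congrArg (Polynomial.map (eval Q)) hab
  simp only [Polynomial.map_add, Polynomial.map_mul, Polynomial.map_C] at hab'
  refine ⟨O, Q, ?_, ?_⟩
  · by_contra hh; push Not at hh
    have hO0 : ∃ i, O i ≠ 0 := by
      by_contra h3; push Not at h3
      apply hO
      have : O = 0 := by ext i; simp [h3 i]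
      rw [this, eval_zero, constantCoeff_eq]
      exact hg1.coeff_eq_zero (by simpa using he.symm)
    obtain ⟨i, hi⟩ := hO0
    have hQO : ∀ j, Q j + O j * (-(Q i / O i)) = 0 := by
      intro j; have := hh i j; field_simp; linear_combination this
    have hev : ∀ g : S, g.IsHomogeneous e →
        Polynomial.eval (-(Q i / O i)) ((nfSh O g).map (eval Q)) = 0 := by
      intro g hg
      have : ((Polynomial.evalRingHom (-(Q i / O i))).comp
          ((Polynomial.mapRingHom (eval Q)).comp (nfSh O))) = eval (0 : Fin 3 → ℂ) := by
        apply MvPolynomial.ringHom_ext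
        · intro r; simp [nfSh]
        · intro j; simp [nfSh]; have := hQO j; linear_combination this
      have h2 := DFunLike.congr_fun this g
      simp only [RingHom.comp_apply, Polynomial.coe_evalRingHom, Polynomial.coe_mapRingHom] at h2
      rw [h2, eval_zero, constantCoeff_eq]
      exact hg.coeff_eq_zero (by simpa using he.symm)
    have := congrArg (Polynomial.eval (-(Q i / O i))) hab'
    simp only [Polynomial.eval_add, Polynomial.eval_mul, hev _ hg1, hev _ hg2, Polynomial.eval_C] at this
    apply hQ; rw [← this]; simp
  · set ψ : S →ₐ[ℂ] MvPolynomial (Fin 2) ℂ := aeval (fun i => C (O i) * X 0 + C (Q i) * X 1)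
    let δ : MvPolynomial (Fin 2) ℂ →ₐ[ℂ] Polynomial ℂ := aeval ![Polynomial.X, 1]
    have hδ : ∀ g, δ (ψ g) = (nfSh O g).map (eval Q) := by
      intro g
      have : ((δ : MvPolynomial (Fin 2) ℂ →+* Polynomial ℂ).comp (ψ : S →+* _)) =
          (Polynomial.mapRingHom (eval Q)).comp (nfSh O) := by
        apply MvPolynomial.ringHom_ext
        · intro r; simp [nfSh]
        · intro j; simp [nfSh, ψ, δ, ← algebraMap_eq]; ring
      exact DFunLike.congr_fun this g
    intro p hp1 hp2
    have u1 : IsUnit (δ p) := by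
      have d1 := map_dvd δ hp1
      have d2 := map_dvd δ hp2
      rw [hδ] at d1 d2
      have := dvd_add (d1.mul_left (a.map (eval Q))) (d2.mul_left (b.map (eval Q)))
      rw [hab'] at this
      exact isUnit_of_dvd_unit this ((isUnit_iff_ne_zero.2 hQ).map Polynomial.C)
    obtain ⟨q, hq⟩ := hp1
    obtain ⟨hd, hc⟩ := nfSh_degree O g1 e hg1
    have hdeg : e ≤ (δ (ψ g1)).natDegree := by
      rw [hδ]
      apply Polynomial.le_natDegree_of_ne_zero
      rw [Polynomial.coeff_map, hc]; simpa using hO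
    have hψ0 : ψ g1 ≠ 0 := by
      intro h5; rw [h5] at hdeg; simp at hdeg; exact he hdeg
    have hψh : (ψ g1).IsHomogeneous e := by
      have := hg1.aeval (fun i => C (O i) * X 0 + C (Q i) * X 1 : Fin 3 → MvPolynomial (Fin 2) ℂ) (n := 1)
        (fun i => (isHomogeneous_C_mul_X _ _).add (isHomogeneous_C_mul_X _ _))
      rw [one_mul] at this; exact this
    have hp0 : p ≠ 0 := by rintro rfl; simp at hq; exact hψ0 hq
    have hq0 : q ≠ 0 := by rintro rfl; simp at hq; exact hψ0 hq
    have t1 : p.totalDegree + q.totalDegree = e := by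
      rw [← totalDegree_mul_of_isDomain hp0 hq0, ← hq, hψh.totalDegree hψ0]
    have t2 : e ≤ q.totalDegree := by
      refine hdeg.trans ?_
      rw [hq, map_mul]
      refine (Polynomial.natDegree_mul_le).trans ?_
      rw [Polynomial.natDegree_eq_zero_of_isUnit u1, zero_add]
      have := aeval_natDegree_le q le_rfl (![Polynomial.X, 1] : Fin 2 → Polynomial ℂ) (n := 1) (by
        intro i; fin_cases i <;> simp)
      simpa using this
    have t3 : p.totalDegree = 0 := by omega
    rw [totalDegree_eq_zero_iff_eq_C] at t3
    rw [t3]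
    have : coeff 0 p ≠ 0 := by
      intro h5; rw [h5] at t3; exact hp0 (by simpa using t3)
    exact (isUnit_iff_ne_zero.2 this).map C

structure NFD where
  e : ℕ
  g1 : S
  g2 : S
  h : S
  l : S
  ψ : S →ₐ[ℂ] MvPolynomial (Fin 2) ℂ
  ι : MvPolynomial (Fin 2) ℂ →ₐ[ℂ] S
  he : 2 ≤ e
  hg1 : g1.IsHomogeneous e
  hg2 : g2.IsHomogeneous e
  hh : h.IsHomogeneous e
  hl : l.IsHomogeneous 1
  hl0 : l ≠ 0
  hψ : ∀ u n, u.IsHomogeneous n → (ψ u).IsHomogeneous n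
  hι : ∀ u n, u.IsHomogeneous n → (ι u).IsHomogeneous n
  hψι : ∀ b, ψ (ι b) = b
  hψl : ψ l = 0
  hιψ : ∀ u, l ∣ u - ι (ψ u)
  hrel : IsRelPrime (ψ g1) (ψ g2)

theorem nf_line (g1 g2 h : S) (e : ℕ) (he : 2 ≤ e) (hg1 : g1.IsHomogeneous e)
    (hg2 : g2.IsHomogeneous e) (hh : h.IsHomogeneous e) (h0 : g1 ≠ 0) (hrel : IsRelPrime g1 g2) :
    ∃ D : NFD, D.e = e ∧ D.g1 = g1 ∧ D.g2 = g2 ∧ D.h = h := by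
  obtain ⟨O, Q, ⟨i, j, hij⟩, hr⟩ := nf_goodpts g1 g2 e (by omega) hg1 hg2 h0 hrel
  have hne : i ≠ j := by rintro rfl; simp at hij
  obtain ⟨k, hki, hkj, hk⟩ : ∃ k : Fin 3, k ≠ i ∧ k ≠ j ∧ ∀ m, m = i ∨ m = j ∨ m = k := by
    have : ∀ i j : Fin 3, i ≠ j → ∃ k : Fin 3, k ≠ i ∧ k ≠ j ∧ ∀ m, m = i ∨ m = j ∨ m = k := by decide
    exact this i j hne
  set Δ := O i * Q j - O j * Q i with hΔ
  let ψ : S →ₐ[ℂ] MvPolynomial (Fin 2) ℂ := aeval (fun i => C (O i) * X 0 + C (Q i) * X 1)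
  let y0 : S := C (Q j / Δ) * X i - C (Q i / Δ) * X j
  let y1 : S := C (O i / Δ) * X j - C (O j / Δ) * X i
  let ι : MvPolynomial (Fin 2) ℂ →ₐ[ℂ] S := aeval ![y0, y1]
  let l : S := X k - C (O k) * y0 - C (Q k) * y1
  have ψX : ∀ m, ψ (X m) = C (O m) * X 0 + C (Q m) * X 1 := fun m => by simp [ψ]
  have ψC : ∀ m, ψ (C m) = C m := fun m => by simp [ψ]
  have ιC : ∀ m, ι (C m) = C m := fun m => by simp [ι]
  have ιX0 : ι (X 0) = y0 := by simp [ι]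
  have ιX1 : ι (X 1) = y1 := by simp [ι]
  have cc : ∀ a b c d : ℂ, a * b = c * d → (C a * C b : MvPolynomial (Fin 2) ℂ) = C c * C d := by
    intro a b c d h; rw [← C_mul, ← C_mul, h]
  have ψy0 : ψ y0 = X 0 := by
    simp only [y0, map_sub, map_mul, ψX, ψC]
    have e1 : (C (Q j / Δ) * C (O i) - C (Q i / Δ) * C (O j) : MvPolynomial (Fin 2) ℂ) = 1 := by
      rw [← C_mul, ← C_mul, ← C_sub, ← C_1]; congr 1; field_simp; rw [hΔ]; ring
    have e2 := cc (Q j / Δ) (Q i) (Q i / Δ) (Q j) (by ring)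
    linear_combination (X 0) * e1 + (X 1) * e2
  have ψy1 : ψ y1 = X 1 := by
    simp only [y1, map_sub, map_mul, ψX, ψC]
    have e1 : (C (O i / Δ) * C (Q j) - C (O j / Δ) * C (Q i) : MvPolynomial (Fin 2) ℂ) = 1 := by
      rw [← C_mul, ← C_mul, ← C_sub, ← C_1]; congr 1; field_simp; rw [hΔ]
    have e2 := cc (O i / Δ) (O j) (O j / Δ) (O i) (by ring)
    linear_combination (X 1) * e1 + (X 0) * e2
  have y0h : y0.IsHomogeneous 1 := (isHomogeneous_C_mul_X _ _).sub (isHomogeneous_C_mul_X _ _)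
  have y1h : y1.IsHomogeneous 1 := (isHomogeneous_C_mul_X _ _).sub (isHomogeneous_C_mul_X _ _)
  have hm : ∀ m, X m - ι (ψ (X m)) = 0 ∨ X m - ι (ψ (X m)) = l := by
    intro m
    rw [ψX]
    simp only [map_add, map_mul, ιC, ιX0, ιX1]
    have cs : ∀ a b c d : ℂ, a * b = c * d → (C a * C b : S) = C c * C d := by
      intro a b c d h; rw [← C_mul, ← C_mul, h]
    rcases hk m with rfl | rfl | rfl
    · left
      simp only [y0, y1]
      have e1 : (C (O m) * C (Q j / Δ) - C (Q m) * C (O j / Δ) : S) = 1 := by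
        rw [← C_mul, ← C_mul, ← C_sub, ← C_1]; congr 1; field_simp; rw [hΔ]; ring
      have e2 := cs (O m) (Q m / Δ) (Q m) (O m / Δ) (by ring)
      linear_combination -(X m) * e1 + (X j) * e2
    · left
      simp only [y0, y1]
      have e1 : (- (C (O m) * C (Q i / Δ)) + C (Q m) * C (O i / Δ) : S) = 1 := by
        rw [← C_mul, ← C_mul, ← C_neg, ← C_add, ← C_1]; congr 1; field_simp; rw [hΔ]; ring
      have e2 := cs (O m) (Q m / Δ) (Q m) (O m / Δ) (by ring)
      linear_combination -(X m) * e1 - (X i) * e2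
    · right; simp only [l]; ring
  refine ⟨⟨e, g1, g2, h, l, ψ, ι, he, hg1, hg2, hh, ?_, ?_, ?_, ?_, ?_, ?_, ?_, hr⟩, rfl, rfl, rfl, rfl⟩
  · refine ((isHomogeneous_X _ _).sub ?_).sub ?_
    · simpa using (isHomogeneous_C _ (O k)).mul y0h
    · simpa using (isHomogeneous_C _ (Q k)).mul y1h
  · intro hl
    have := congrArg (pderiv k) hl
    simp [l, y0, y1, pderiv_X_of_ne hki.symm,
      pderiv_X_of_ne hkj.symm] at this
  · intro u n hu
    have := hu.aeval (fun i => C (O i) * X 0 + C (Q i) * X 1 : Fin 3 → MvPolynomial (Fin 2) ℂ) (n := 1)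
        (fun i => (isHomogeneous_C_mul_X _ _).add (isHomogeneous_C_mul_X _ _))
    rw [one_mul] at this; exact this
  · intro u n hu
    have := hu.aeval ![y0, y1] (n := 1) (fun i => by fin_cases i <;> assumption)
    rw [one_mul] at this; exact this
  · intro b
    have : ψ.comp ι = AlgHom.id ℂ _ := by
      apply MvPolynomial.algHom_ext
      intro i
      rw [AlgHom.comp_apply]
      fin_cases i
      · exact (congrArg ψ ιX0).trans ψy0
      · exact (congrArg ψ ιX1).trans ψy1
    exact DFunLike.congr_fun this b
  · simp only [l, map_sub, map_mul, ψX, ψC, ψy0, ψy1]; ring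
  · intro u
    induction u using MvPolynomial.induction_on with
    | C a => simp [ψC, ιC]
    | add p q hp hq =>
      have := dvd_add hp hq
      simp only [map_add]
      convert this using 1; ring
    | mul_X p m hp =>
      have h2 : l ∣ X m - ι (ψ (X m)) := by
        rcases hm m with h | h <;> rw [h]; simp
      have := dvd_add (hp.mul_right (X m)) (h2.mul_left (ι (ψ p)))
      rw [map_mul, map_mul]
      convert this using 1; ring

theorem nf_bin_finrank (k : ℕ) : Module.finrank ℂ (homogeneousSubmodule (Fin 2) ℂ k) = k + 1 := by
  rw [homogeneousSubmodule_eq_finsupp_supported]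
  have e1 := (AddMonoidAlgebra.supportedEquivFinsupp (S := ℂ) (R := ℂ) {d : Fin 2 →₀ ℕ | d.degree = k}).finrank_eq
  let eq : {d : Fin 2 →₀ ℕ | d.degree = k} ≃ Fin (k + 1) :=
    { toFun := fun d => ⟨d.1 0, by
        have := d.2
        simp only [Set.mem_ofPred_eq, Finsupp.degree_eq_sum, Fin.sum_univ_two] at this
        omega⟩
      invFun := fun i => ⟨Finsupp.equivFunOnFinite.symm ![i, k - i], by
        simp [Finsupp.degree_eq_sum, Fin.sum_univ_two]; omega⟩
      left_inv := fun d => by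
        have := d.2
        simp only [Set.mem_ofPred_eq, Finsupp.degree_eq_sum, Fin.sum_univ_two] at this
        apply Subtype.ext
        ext i
        fin_cases i
        · simp
        · simp; omega
      right_inv := fun i => by simp }
  have : Finite {d : Fin 2 →₀ ℕ | d.degree = k} := Finite.of_equiv _ eq.symm
  have : Fintype {d : Fin 2 →₀ ℕ | d.degree = k} := Fintype.ofFinite _
  refine e1.trans ?_
  rw [Module.finrank_finsupp_self, Fintype.card_congr eq, Fintype.card_fin]

theorem nf_codim_one {V : Type} [AddCommGroup V] [Module ℂ V] (R E : Submodule ℂ V) [FiniteDimensional ℂ E]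
    (h : R ≤ E) (hf : Module.finrank ℂ E ≤ Module.finrank ℂ R + 1) :
    ∃ w0 ∈ E, ∀ w ∈ E, ∃ c : ℂ, w - c • w0 ∈ R := by
  by_cases hRE : E ≤ R
  · exact ⟨0, E.zero_mem, fun w hw => ⟨0, by simpa using hRE hw⟩⟩
  · obtain ⟨w0, hw0, hw0'⟩ := SetLike.not_le_iff_exists.1 hRE
    refine ⟨w0, hw0, fun w hw => ?_⟩
    have hle : R ⊔ Submodule.span ℂ {w0} ≤ E := sup_le h (by simpa using hw0)
    have hlt : R < R ⊔ Submodule.span ℂ {w0} := by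
      refine lt_of_le_of_ne le_sup_left fun hh => hw0' ?_
      rw [hh]; exact Submodule.mem_sup_right (Submodule.mem_span_singleton_self _)
    have : FiniteDimensional ℂ ↥(R ⊔ Submodule.span ℂ {w0}) := Submodule.finiteDimensional_of_le hle
    have h1 := Submodule.finrank_lt_finrank_of_lt hlt
    have h2 := Submodule.eq_of_le_of_finrank_le hle (by omega)
    rw [← h2] at hw
    obtain ⟨r, hr, s, hs, rfl⟩ := Submodule.mem_sup.1 hw
    obtain ⟨c, rfl⟩ := Submodule.mem_span_singleton.1 hs
    exact ⟨c, by simpa using hr⟩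

theorem nf_pair_hom {σ : Type} (G1 G2 : MvPolynomial σ ℂ) (e j : ℕ) (h1 : G1.IsHomogeneous e)
    (h2 : G2.IsHomogeneous e) (u : MvPolynomial σ ℂ) (hu : u.IsHomogeneous j)
    (hm : u ∈ Ideal.span {G1, G2}) :
    ∃ a b, u = a * G1 + b * G2 ∧ a.IsHomogeneous (j - e) ∧ b.IsHomogeneous (j - e) ∧
      (j < e → a = 0 ∧ b = 0) := by
  have hr : Set.range ![G1, G2] = {G1, G2} := by simp [Set.pair_comm]
  obtain ⟨a, ha, hb, hc⟩ := nf_mem_span_hom ![G1, G2] e j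
    (by intro i; fin_cases i <;> assumption) u (by rw [hr]; exact hm)
  rw [homogeneousComponent_of_mem hu, if_pos rfl] at ha
  have hz : ∀ i, (a i).IsHomogeneous (j - e) := fun i => by
    rcases le_or_gt e j with h | h
    · exact hb h i
    · rw [hc h i]; exact isHomogeneous_zero _ _ _
  refine ⟨a 0, a 1, by simpa [Fin.sum_univ_two] using ha, hz 0, hz 1, fun h => ⟨hc h 0, hc h 1⟩⟩

theorem nf_bin_zero_of_dvd (G x : MvPolynomial (Fin 2) ℂ) (e k : ℕ) (hG : G.IsHomogeneous e)
    (hx : x.IsHomogeneous k) (hk : k < e) (hd : G ∣ x) : x = 0 := by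
  by_contra hx0
  have hG0 : G ≠ 0 := by rintro rfl; exact hx0 (zero_dvd_iff.1 hd)
  have := totalDegree_le_of_dvd_of_isDomain hd hx0
  rw [hG.totalDegree hG0, hx.totalDegree hx0] at this
  omega

theorem nf_bin_ne (G1 G2 : MvPolynomial (Fin 2) ℂ) (e : ℕ) (he : 2 ≤ e) (h1 : G1.IsHomogeneous e)
    (hrel : IsRelPrime G1 G2) : G2 ≠ 0 := by
  rintro rfl
  have hu : IsUnit G1 := hrel dvd_rfl (dvd_zero _)
  have := totalDegree_le_of_dvd_of_isDomain hu.dvd (one_ne_zero (α := MvPolynomial (Fin 2) ℂ))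
  rw [h1.totalDegree hu.ne_zero] at this
  simp at this; omega

def nfPhi (G1 G2 : MvPolynomial (Fin 2) ℂ) (a : ℕ) :
    (homogeneousSubmodule (Fin 2) ℂ a × homogeneousSubmodule (Fin 2) ℂ a) →ₗ[ℂ] MvPolynomial (Fin 2) ℂ :=
  LinearMap.coprod ((LinearMap.mulRight ℂ G1).comp (Submodule.subtype _))
    ((LinearMap.mulRight ℂ G2).comp (Submodule.subtype _))

theorem nfPhi_apply (G1 G2 : MvPolynomial (Fin 2) ℂ) (a : ℕ) (p) :
    nfPhi G1 G2 a p = p.1.1 * G1 + p.2.1 * G2 := by simp [nfPhi]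

theorem nfPhi_range (G1 G2 : MvPolynomial (Fin 2) ℂ) (e : ℕ) (he : 2 ≤ e) (h1 : G1.IsHomogeneous e)
    (h2 : G2.IsHomogeneous e) (hrel : IsRelPrime G1 G2) (a : ℕ) (ha : a < e) :
    LinearMap.range (nfPhi G1 G2 a) ≤ homogeneousSubmodule (Fin 2) ℂ (a + e) ∧
    Module.finrank ℂ (LinearMap.range (nfPhi G1 G2 a)) = 2 * (a + 1) := by
  have : FiniteDimensional ℂ (homogeneousSubmodule (Fin 2) ℂ a) :=
    Module.Finite.iff_fg.2 (homogeneousSubmodule_fg _ _ _)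
  constructor
  · rintro _ ⟨p, rfl⟩
    rw [nfPhi_apply]
    exact (IsHomogeneous.mul p.1.2 h1).add (IsHomogeneous.mul p.2.2 h2)
  · rw [LinearMap.finrank_range_of_inj, Module.finrank_prod, nf_bin_finrank]; · ring
    rw [← LinearMap.ker_eq_bot, LinearMap.ker_eq_bot']
    rintro ⟨⟨p, hp⟩, ⟨q, hq⟩⟩ hpq
    rw [nfPhi_apply] at hpq
    simp only at hpq
    have d1 : G2 ∣ p * G1 := ⟨-q, by linear_combination hpq⟩
    have d2 : G1 ∣ q * G2 := ⟨-p, by linear_combination hpq⟩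
    have p0 := nf_bin_zero_of_dvd G2 p e a h2 hp ha (hrel.symm.dvd_of_dvd_mul_right d1)
    have q0 := nf_bin_zero_of_dvd G1 q e a h1 hq ha (hrel.dvd_of_dvd_mul_right d2)
    subst p0; subst q0; rfl

theorem nfPhi_mem (G1 G2 : MvPolynomial (Fin 2) ℂ) (a : ℕ) (u) (hu : u ∈ LinearMap.range (nfPhi G1 G2 a)) :
    u ∈ Ideal.span {G1, G2} := by
  obtain ⟨p, rfl⟩ := hu
  rw [nfPhi_apply]
  exact Ideal.mem_span_pair.2 ⟨_, _, rfl⟩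

theorem nf_hom_succ {σ : Type} [Fintype σ] (I : Ideal (MvPolynomial σ ℂ)) (k : ℕ)
    (h : ∀ u : MvPolynomial σ ℂ, u.IsHomogeneous k → u ∈ I) (n : ℕ) (hn : k ≤ n) :
    ∀ u : MvPolynomial σ ℂ, u.IsHomogeneous n → u ∈ I := by
  induction n, hn using Nat.le_induction with
  | base => exact h
  | succ n hn ih =>
    intro u hu
    rw [u.as_sum]
    refine Ideal.sum_mem _ fun m hm => ?_
    have hdeg : m.degree = n + 1 := by
      have := hu (mem_support_iff.1 hm)
      rwa [Finsupp.degree_eq_weight_one]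
    obtain ⟨i, hi⟩ : ∃ i, m i ≠ 0 := by
      by_contra hh; push Not at hh
      have : m = 0 := by ext i; simp [hh i]
      rw [this] at hdeg; simp at hdeg
    have hm' : m = (m - Finsupp.single i 1) + Finsupp.single i 1 := by
      rw [tsub_add_cancel_of_le]; simpa using Nat.one_le_iff_ne_zero.2 hi
    have : monomial m (coeff m u) = monomial (m - Finsupp.single i 1) (coeff m u) * X i := by
      rw [X, monomial_mul, mul_one, ← hm']
    rw [this]
    apply Ideal.mul_mem_right
    apply ih
    apply isHomogeneous_monomial
    have := congrArg Finsupp.degree hm'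
    rw [map_add, Finsupp.degree_single, hdeg] at this
    omega

theorem nf_bin_top (G1 G2 : MvPolynomial (Fin 2) ℂ) (e : ℕ) (he : 2 ≤ e) (h1 : G1.IsHomogeneous e)
    (h2 : G2.IsHomogeneous e) (hrel : IsRelPrime G1 G2) (n : ℕ) (hn : 2 * e - 1 ≤ n) :
    ∀ u : MvPolynomial (Fin 2) ℂ, u.IsHomogeneous n → u ∈ Ideal.span {G1, G2} := by
  refine nf_hom_succ _ (2 * e - 1) ?_ n hn
  intro u hu
  obtain ⟨hle, hf⟩ := nfPhi_range G1 G2 e he h1 h2 hrel (e - 1) (by omega)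
  have e1 : e - 1 + e = 2 * e - 1 := by omega
  rw [e1] at hle
  have : FiniteDimensional ℂ (homogeneousSubmodule (Fin 2) ℂ (2 * e - 1)) :=
    Module.Finite.iff_fg.2 (homogeneousSubmodule_fg _ _ _)
  have := Submodule.eq_of_le_of_finrank_eq hle (by rw [hf, nf_bin_finrank]; omega)
  apply nfPhi_mem G1 G2 (e - 1)
  rw [this]; exact hu

theorem nf_bin_sub (G1 G2 : MvPolynomial (Fin 2) ℂ) (e : ℕ) (he : 2 ≤ e) (h1 : G1.IsHomogeneous e)
    (h2 : G2.IsHomogeneous e) (hrel : IsRelPrime G1 G2) :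
    ∃ w0 : MvPolynomial (Fin 2) ℂ, w0.IsHomogeneous (2 * e - 2) ∧ ∀ w : MvPolynomial (Fin 2) ℂ,
      w.IsHomogeneous (2 * e - 2) → ∃ c : ℂ, w - c • w0 ∈ Ideal.span {G1, G2} := by
  obtain ⟨hle, hf⟩ := nfPhi_range G1 G2 e he h1 h2 hrel (e - 2) (by omega)
  have e1 : e - 2 + e = 2 * e - 2 := by omega
  rw [e1] at hle
  have : FiniteDimensional ℂ (homogeneousSubmodule (Fin 2) ℂ (2 * e - 2)) :=
    Module.Finite.iff_fg.2 (homogeneousSubmodule_fg _ _ _)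
  obtain ⟨w0, hw0, hw⟩ := nf_codim_one _ _ hle (by rw [hf, nf_bin_finrank]; omega)
  refine ⟨w0, hw0, fun w hw' => ?_⟩
  obtain ⟨c, hc⟩ := hw w hw'
  exact ⟨c, nfPhi_mem _ _ _ _ hc⟩

theorem nf_bin_socle (G1 G2 : MvPolynomial (Fin 2) ℂ) (e : ℕ) (he : 2 ≤ e) (h1 : G1.IsHomogeneous e)
    (h2 : G2.IsHomogeneous e) (hrel : IsRelPrime G1 G2) (i : ℕ) (hi : i < 2 * e - 2)
    (u : MvPolynomial (Fin 2) ℂ) (hu : u.IsHomogeneous i)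
    (hx : u * X 0 ∈ Ideal.span {G1, G2}) (hy : u * X 1 ∈ Ideal.span {G1, G2}) :
    u ∈ Ideal.span {G1, G2} := by
  obtain ⟨a, b, hab, ha, hb, -⟩ := nf_pair_hom G1 G2 e (i + 1) h1 h2 _ (hu.mul (isHomogeneous_X _ _)) hx
  obtain ⟨a', b', hab', ha', hb', -⟩ := nf_pair_hom G1 G2 e (i + 1) h1 h2 _ (hu.mul (isHomogeneous_X _ _)) hy
  have e1 : (X 1 * a - X 0 * a') * G1 + (X 1 * b - X 0 * b') * G2 = 0 := by
    linear_combination (X 0) * hab' - (X 1) * hab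
  have hx : (X 1 * a - X 0 * a').IsHomogeneous (1 + (i + 1 - e)) :=
    ((isHomogeneous_X _ _).mul ha).sub ((isHomogeneous_X _ _).mul ha')
  have z1 := nf_bin_zero_of_dvd G2 _ e _ h2 hx (by omega)
    (hrel.symm.dvd_of_dvd_mul_right ⟨-(X 1 * b - X 0 * b'), by linear_combination e1⟩)
  rw [z1, zero_mul, zero_add] at e1
  have hG2 := nf_bin_ne G1 G2 e he h1 hrel
  have z2 := (mul_eq_zero.1 e1).resolve_right hG2
  have hp : Prime (X 0 : MvPolynomial (Fin 2) ℂ) := X_prime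
  have hnd : ¬ (X 0 : MvPolynomial (Fin 2) ℂ) ∣ X 1 := by
    rw [X_dvd_X]; simp
  obtain ⟨a2, ha2⟩ : X 0 ∣ a := (hp.dvd_or_dvd ⟨a', sub_eq_zero.1 z1⟩).resolve_left hnd
  obtain ⟨b2, hb2⟩ : X 0 ∣ b := (hp.dvd_or_dvd ⟨b', sub_eq_zero.1 z2⟩).resolve_left hnd
  refine Ideal.mem_span_pair.2 ⟨a2, b2, ?_⟩
  apply mul_left_cancel₀ hp.ne_zero
  rw [ha2, hb2] at hab
  linear_combination -hab

theorem nf_bin_pair (G1 G2 : MvPolynomial (Fin 2) ℂ) (e : ℕ) (he : 2 ≤ e) (h1 : G1.IsHomogeneous e)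
    (h2 : G2.IsHomogeneous e) (hrel : IsRelPrime G1 G2) (i j : ℕ) (hi : i + j = 2 * e - 2)
    (u : MvPolynomial (Fin 2) ℂ) (hu : u.IsHomogeneous i) (hn : u ∉ Ideal.span {G1, G2}) :
    ∃ v : MvPolynomial (Fin 2) ℂ, v.IsHomogeneous j ∧ u * v ∉ Ideal.span {G1, G2} := by
  induction j generalizing i u with
  | zero => exact ⟨1, isHomogeneous_one _ _, by simpa using hn⟩
  | succ j ih =>
    have : ∃ m : Fin 2, u * X m ∉ Ideal.span {G1, G2} := by
      by_contra hh; push Not at hh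
      exact hn (nf_bin_socle G1 G2 e he h1 h2 hrel i (by omega) u hu (hh 0) (hh 1))
    obtain ⟨m, hm⟩ := this
    obtain ⟨v, hv, hv'⟩ := ih (i + 1) (by omega) (u * X m) (hu.mul (isHomogeneous_X _ _)) hm
    refine ⟨X m * v, ?_, by rwa [← mul_assoc]⟩
    rw [add_comm]; exact (isHomogeneous_X _ _).mul hv

namespace NFD
variable (D : NFD)

def A : Ideal S := Ideal.span {D.g1, D.g2}
def J : Ideal S := Ideal.span {D.g1, D.g2, D.h}
def I : Ideal S := Ideal.span {D.g1, D.g2, D.l - 1}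
def G : Ideal (MvPolynomial (Fin 2) ℂ) := Ideal.span {D.ψ D.g1, D.ψ D.g2}

theorem memA (u : S) : u ∈ D.A ↔ ∃ a b, a * D.g1 + b * D.g2 = u := Ideal.mem_span_pair

theorem memJ (u : S) : u ∈ D.J ↔ ∃ a c, a ∈ D.A ∧ u = a + c * D.h := by
  unfold J
  constructor
  · intro h
    obtain ⟨a, b, c, h⟩ := Submodule.mem_span_triple.1 h
    refine ⟨a * D.g1 + b * D.g2, c, (D.memA _).2 ⟨a, b, rfl⟩, by rw [← h]; simp⟩
  · rintro ⟨a, c, ha, rfl⟩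
    obtain ⟨p, q, rfl⟩ := (D.memA _).1 ha
    exact Submodule.mem_span_triple.2 ⟨p, q, c, by simp⟩

theorem memI (u : S) : u ∈ D.I ↔ ∃ a c, a ∈ D.A ∧ u = a + (D.l - 1) * c := by
  unfold I
  constructor
  · intro h
    obtain ⟨a, b, c, h⟩ := Submodule.mem_span_triple.1 h
    refine ⟨a * D.g1 + b * D.g2, c, (D.memA _).2 ⟨a, b, rfl⟩, by rw [← h]; simp; ring⟩
  · rintro ⟨a, c, ha, rfl⟩
    obtain ⟨p, q, rfl⟩ := (D.memA _).1 ha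
    exact Submodule.mem_span_triple.2 ⟨p, q, c, by simp; ring⟩

theorem A_le_I : D.A ≤ D.I := fun u hu => (D.memI u).2 ⟨u, 0, hu, by simp⟩
theorem A_le_J : D.A ≤ D.J := fun u hu => (D.memJ u).2 ⟨u, 0, hu, by simp⟩

theorem A_hc (u : S) (hu : u ∈ D.A) (j : ℕ) : homogeneousComponent j u ∈ D.A := by
  have hr : Set.range ![D.g1, D.g2] = {D.g1, D.g2} := by simp [Set.pair_comm]
  have := nf_span_hc ![D.g1, D.g2] D.e j (by intro i; fin_cases i; exacts [D.hg1, D.hg2]) u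
    (by rw [hr]; exact hu)
  rw [hr] at this; exact this

theorem ψA (u : S) (hu : u ∈ D.A) : D.ψ u ∈ D.G := by
  obtain ⟨a, b, rfl⟩ := (D.memA u).1 hu
  exact Ideal.mem_span_pair.2 ⟨D.ψ a, D.ψ b, by simp⟩

theorem of_ψ (u : S) (hu : D.ψ u ∈ D.G) : ∃ a c, a ∈ D.A ∧ u = a + D.l * c := by
  obtain ⟨a, b, h⟩ := Ideal.mem_span_pair.1 hu
  obtain ⟨c0, h0⟩ := D.hιψ u
  obtain ⟨c1, h1⟩ := D.hιψ D.g1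
  obtain ⟨c2, h2⟩ := D.hιψ D.g2
  have h' := congrArg D.ι h
  simp only [map_add, map_mul] at h'
  refine ⟨D.ι a * D.g1 + D.ι b * D.g2, c0 - D.ι a * c1 - D.ι b * c2, (D.memA _).2 ⟨_, _, rfl⟩, ?_⟩
  linear_combination h0 - D.ι a * h1 - D.ι b * h2 - h'

theorem ψ_of (a c : S) (ha : a ∈ D.A) : D.ψ (a + D.l * c) ∈ D.G := by
  rw [map_add, map_mul, D.hψl, zero_mul, add_zero]; exact D.ψA a ha

theorem nzd (u : S) (hu : D.l * u ∈ D.A) : u ∈ D.A := by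
  obtain ⟨a, b, h⟩ := (D.memA _).1 hu
  have h' := congrArg D.ψ h
  simp only [map_add, map_mul, D.hψl, zero_mul] at h'
  have hG2 := nf_bin_ne _ _ D.e D.he (D.hψ _ _ D.hg1) D.hrel
  obtain ⟨c, hc⟩ : D.ψ D.g2 ∣ D.ψ a :=
    D.hrel.symm.dvd_of_dvd_mul_right ⟨-D.ψ b, by linear_combination h'⟩
  have hc' : D.ψ b = - c * D.ψ D.g1 := by
    apply mul_right_cancel₀ hG2
    rw [hc] at h'; linear_combination h'
  obtain ⟨a0, ha0⟩ := D.hιψ a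
  obtain ⟨b0, hb0⟩ := D.hιψ b
  obtain ⟨c1, h1⟩ := D.hιψ D.g1
  obtain ⟨c2, h2⟩ := D.hιψ D.g2
  rw [hc, map_mul] at ha0
  rw [hc', map_mul, map_neg] at hb0
  refine (D.memA _).2 ⟨a0 - D.ι c * c2, b0 + D.ι c * c1, ?_⟩
  apply mul_left_cancel₀ D.hl0
  rw [← h]
  linear_combination (-D.g1) * ha0 - D.g2 * hb0 + D.ι c * D.g1 * h2 - D.ι c * D.g2 * h1

theorem nzd_pow (n : ℕ) (u : S) (hu : D.l ^ n * u ∈ D.A) : u ∈ D.A := by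
  induction n with
  | zero => simpa using hu
  | succ n ih => exact ih (D.nzd _ (by rwa [← mul_assoc, ← pow_succ']))

theorem hc_l (c : S) (k : ℕ) : homogeneousComponent (k + 1) (D.l * c) = D.l * homogeneousComponent k c := by
  rw [mul_comm, nf_hc_mul _ _ 1 _ D.hl, if_pos (by omega), Nat.add_sub_cancel, mul_comm]

theorem hc_l0 (c : S) : homogeneousComponent 0 (D.l * c) = 0 := by
  rw [mul_comm, nf_hc_mul _ _ 1 _ D.hl, if_neg (by omega)]

/-- graded version -/
theorem of_ψ_hom (u : S) (k : ℕ) (hk : u.IsHomogeneous (k + 1)) (hu : D.ψ u ∈ D.G) :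
    ∃ a c, a ∈ D.A ∧ c.IsHomogeneous k ∧ u = a + D.l * c := by
  obtain ⟨a, c, ha, h⟩ := D.of_ψ u hu
  refine ⟨homogeneousComponent (k+1) a, homogeneousComponent k c, D.A_hc a ha _,
    homogeneousComponent_isHomogeneous _ _, ?_⟩
  have := congrArg (homogeneousComponent (k+1)) h
  rwa [homogeneousComponent_of_mem hk, if_pos rfl, map_add, hc_l] at this

theorem of_ψ_hom0 (u : S) (hk : u.IsHomogeneous 0) (hu : D.ψ u ∈ D.G) : u ∈ D.A := by
  obtain ⟨a, c, ha, h⟩ := D.of_ψ u hu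
  have := congrArg (homogeneousComponent 0) h
  rw [homogeneousComponent_of_mem hk, if_pos rfl, map_add, hc_l0, add_zero] at this
  rw [this]; exact D.A_hc a ha _

theorem F1 (u : S) (i : ℕ) (hi : u.IsHomogeneous i) (hu : u ∈ D.I) : u ∈ D.A := by
  obtain ⟨a, c, ha, h⟩ := (D.memI u).1 hu
  have hcomp : ∀ k, homogeneousComponent (k+1) u = homogeneousComponent (k+1) a
      + D.l * homogeneousComponent k c - homogeneousComponent (k+1) c := by
    intro k
    rw [← hc_l, ← map_add, ← map_sub]; congr 1; rw [h]; ring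
  have hcomp0 : homogeneousComponent 0 u = homogeneousComponent 0 a - homogeneousComponent 0 c := by
    have := D.hc_l0 c
    have h2 : homogeneousComponent 0 u = homogeneousComponent 0 (a + D.l * c - c) := by
      congr 1; rw [h]; ring
    rw [h2, map_sub, map_add, this, add_zero]
  have hz : ∀ k, k ≠ i → homogeneousComponent k u = 0 := fun k hk => by
    rw [homogeneousComponent_of_mem hi, if_neg hk]
  have hA := D.A_hc a ha
  have low : ∀ k, k < i → homogeneousComponent k c ∈ D.A := by
    intro k
    induction k with
    | zero =>
      intro hk
      rw [hz 0 (by omega)] at hcomp0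
      rw [show homogeneousComponent 0 c = homogeneousComponent 0 a by linear_combination hcomp0]
      exact hA 0
    | succ k ih =>
      intro hk
      have := hcomp k
      rw [hz _ (by omega)] at this
      rw [show homogeneousComponent (k+1) c = homogeneousComponent (k+1) a
        + D.l * homogeneousComponent k c by linear_combination this]
      exact D.A.add_mem (hA _) (D.A.mul_mem_left _ (ih (by omega)))
  have high : ∀ m, m ≤ c.totalDegree + 1 → homogeneousComponent (c.totalDegree + 1 + i - m) c ∈ D.A := by
    intro m
    induction m with
    | zero =>
      intro _
      rw [homogeneousComponent_eq_zero _ _ (by omega)]; exact D.A.zero_mem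
    | succ m ih =>
      intro hm
      have ih' := ih (by omega)
      obtain ⟨k, hk⟩ : ∃ k, k = c.totalDegree + 1 + i - (m + 1) := ⟨_, rfl⟩
      rw [← hk]
      rw [show c.totalDegree + 1 + i - m = k + 1 by omega] at ih'
      have := hcomp k
      rw [hz _ (by omega)] at this
      apply D.nzd
      rw [show D.l * homogeneousComponent k c = homogeneousComponent (k+1) c - homogeneousComponent (k+1) a by
        linear_combination -this]
      exact D.A.sub_mem ih' (hA _)
  have hi' : homogeneousComponent i c ∈ D.A := by
    have := high (c.totalDegree + 1) le_rfl
    rwa [show c.totalDegree + 1 + i - (c.totalDegree + 1) = i by omega] at this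
  have hui : homogeneousComponent i u = u := by rw [homogeneousComponent_of_mem hi, if_pos rfl]
  rw [← hui]
  rcases i with _ | i
  · rw [hcomp0]; exact D.A.sub_mem (hA _) hi'
  · rw [hcomp]
    exact D.A.sub_mem (D.A.add_mem (hA _) (D.A.mul_mem_left _ (low i (by omega)))) hi'

theorem top_mem (k : ℕ) (hk : 2 * D.e - 1 ≤ k) (u : S) (hu : u.IsHomogeneous k) : D.ψ u ∈ D.G :=
  nf_bin_top _ _ D.e D.he (D.hψ _ _ D.hg1) (D.hψ _ _ D.hg2) D.hrel k hk _ (D.hψ _ _ hu)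

theorem m_pow_le : mId ^ (2 * D.e - 1) ≤ D.A ⊔ Ideal.span {D.l} := by
  have hm : mId = idealOfVars (Fin 3) ℂ := by
    unfold mId idealOfVars
    congr 1; ext x
    simp [Fin.exists_fin_succ, eq_comm]
  intro u hu
  rw [hm, mem_pow_idealOfVars_iff] at hu
  rw [u.as_sum]
  refine Ideal.sum_mem _ fun m hmm => ?_
  have hd := hu m hmm
  have hψ := D.top_mem m.degree hd (monomial m (coeff m u)) (isHomogeneous_monomial _ rfl)
  obtain ⟨a, c, ha, h⟩ := D.of_ψ _ hψ
  rw [h]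
  exact Ideal.add_mem _ (Ideal.mem_sup_left ha)
    (Ideal.mem_sup_right (Ideal.mul_mem_right _ _ (Ideal.mem_span_singleton_self _)))

theorem sup_pow (n : ℕ) : (D.A ⊔ Ideal.span {D.l}) ^ n ≤ D.A ⊔ Ideal.span {D.l ^ n} := by
  induction n with
  | zero => simp
  | succ n ih =>
    rw [pow_succ]
    refine (Ideal.mul_mono ih le_rfl).trans ?_
    rw [Ideal.mul_le]
    intro r hr t ht
    obtain ⟨a, ha, b, hb, rfl⟩ := Submodule.mem_sup.1 hr
    obtain ⟨c, hc, d, hd, rfl⟩ := Submodule.mem_sup.1 ht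
    obtain ⟨b, rfl⟩ := Ideal.mem_span_singleton.1 hb
    obtain ⟨d, rfl⟩ := Ideal.mem_span_singleton.1 hd
    rw [show (a + D.l ^ n * b) * (c + D.l * d) = ((c + D.l * d) * a + D.l ^ n * b * c)
      + D.l ^ (n + 1) * (b * d) by ring]
    refine Ideal.add_mem _ (Ideal.mem_sup_left ?_) (Ideal.mem_sup_right ?_)
    · exact D.A.add_mem (D.A.mul_mem_left _ ha) (D.A.mul_mem_left _ hc)
    · exact Ideal.mul_mem_right _ _ (Ideal.mem_span_singleton_self _)

theorem l_mem : D.l ∈ mId := by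
  have hm : mId = idealOfVars (Fin 3) ℂ := by
    unfold mId idealOfVars
    congr 1; ext x
    simp [Fin.exists_fin_succ, eq_comm]
  have : D.l ∈ idealOfVars (Fin 3) ℂ ^ 1 := by
    rw [mem_pow_idealOfVars_iff]
    intro x hx
    have := D.hl (mem_support_iff.1 hx)
    rw [Finsupp.degree_eq_weight_one]; exact this.ge
  rw [hm]; simpa using this

theorem sat (f : S) (hJ : Jf f = D.J) (u : S) : u ∈ Isat f ↔ ∃ n, D.l ^ n * u ∈ D.J := by
  unfold Isat
  rw [Submodule.mem_iSup_of_directed]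
  · constructor
    · rintro ⟨n, hn⟩
      refine ⟨n, ?_⟩
      rw [Submodule.mem_colon] at hn
      have := hn (D.l ^ n) (Ideal.pow_mem_pow D.l_mem n)
      rw [hJ] at this
      rw [mul_comm]; exact this
    · rintro ⟨n, hn⟩
      refine ⟨(2 * D.e - 1) * n, ?_⟩
      rw [Submodule.mem_colon]
      intro p hp
      rw [hJ]
      have hp' : p ∈ D.A ⊔ Ideal.span {D.l ^ n} := by
        apply D.sup_pow
        apply Ideal.pow_right_mono D.m_pow_le
        rw [← pow_mul]; exact hp
      obtain ⟨a, ha, b, hb, rfl⟩ := Submodule.mem_sup.1 hp'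
      obtain ⟨b, rfl⟩ := Ideal.mem_span_singleton.1 hb
      rw [smul_eq_mul, mul_add]
      refine D.J.add_mem (D.J.mul_mem_left _ (D.A_le_J ha)) ?_
      rw [show u * (D.l ^ n * b) = b * (D.l ^ n * u) by ring]
      exact D.J.mul_mem_left _ hn
  · apply Monotone.directed_le
    intro a b hab
    apply Submodule.colon_mono le_rfl
    exact Ideal.pow_le_pow_right hab

end NFD

theorem nf_finrank_map {V W : Type} [AddCommGroup V] [Module ℂ V] [AddCommGroup W] [Module ℂ W]
    (f : V →ₗ[ℂ] W) (T : Submodule ℂ V) [FiniteDimensional ℂ T] :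
    Module.finrank ℂ (T.map f) + Module.finrank ℂ ↥(T ⊓ LinearMap.ker f) = Module.finrank ℂ T := by
  have h := LinearMap.finrank_range_add_finrank_ker (f.domRestrict T)
  have e1 : LinearMap.range (f.domRestrict T) = T.map f := by
    rw [LinearMap.domRestrict, LinearMap.range_comp, Submodule.range_subtype]
  have e2 : (LinearMap.ker (f.domRestrict T)).map T.subtype = T ⊓ LinearMap.ker f := by
    rw [LinearMap.domRestrict, LinearMap.ker_comp, Submodule.map_comap_subtype]
  rw [e1] at h
  rw [← e2, Submodule.finrank_map_subtype_eq, h]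

namespace NFD
variable (D : NFD)

abbrev V : Type := S ⧸ D.I
def π : S →ₐ[ℂ] D.V := Ideal.Quotient.mkₐ ℂ D.I

theorem π_eq_zero (u : S) : D.π u = 0 ↔ u ∈ D.I := Ideal.Quotient.eq_zero_iff_mem
theorem π_surj : Function.Surjective D.π := Ideal.Quotient.mk_surjective
theorem π_l : D.π D.l = 1 := by
  rw [← sub_eq_zero, ← map_one D.π, ← map_sub, π_eq_zero]
  exact (D.memI _).2 ⟨0, 1, D.A.zero_mem, by ring⟩
theorem π_A (u : S) (hu : u ∈ D.A) : D.π u = 0 := (D.π_eq_zero u).2 (D.A_le_I hu)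

def W : ℕ → Submodule ℂ D.V
  | 0 => ⊥
  | n + 1 => (homogeneousSubmodule (Fin 3) ℂ n).map D.π.toLinearMap

theorem mem_W_succ (n : ℕ) (v : D.V) : v ∈ D.W (n + 1) ↔ ∃ u : S, u.IsHomogeneous n ∧ D.π u = v := Iff.rfl

theorem mem_W_zero (v : D.V) : v ∈ D.W 0 ↔ v = 0 := Iff.rfl

theorem W_le_succ (n : ℕ) : D.W n ≤ D.W (n + 1) := by
  intro v hv
  rcases n with _ | n
  · rw [mem_W_zero] at hv; rw [hv]; exact Submodule.zero_mem _
  · obtain ⟨u, hu, rfl⟩ := hv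
    refine (D.mem_W_succ _ _).2 ⟨u * D.l, IsHomogeneous.mul hu D.hl, ?_⟩
    rw [map_mul, π_l, mul_one]; rfl

theorem W_mono : Monotone D.W := monotone_nat_of_le_succ D.W_le_succ

theorem W_drop (k : ℕ) (u : S) (hu : u.IsHomogeneous k) (h : D.ψ u ∈ D.G) : D.π u ∈ D.W k := by
  rcases k with _ | k
  · rw [mem_W_zero]; exact D.π_A _ (D.of_ψ_hom0 u hu h)
  · obtain ⟨a, c, ha, hc, rfl⟩ := D.of_ψ_hom u k hu h
    rw [map_add, map_mul, π_l, one_mul, D.π_A a ha, zero_add]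
    exact (D.mem_W_succ _ _).2 ⟨c, hc, rfl⟩

theorem W_hom (k : ℕ) : ∀ (u : S), u.IsHomogeneous k → D.π u ∈ D.W (2 * D.e - 1) := by
  induction k with
  | zero => 
    intro u hu
    have := D.he
    exact D.W_mono (show 1 ≤ 2 * D.e - 1 by omega) ((D.mem_W_succ _ _).2 ⟨u, hu, rfl⟩)
  | succ k ih =>
    intro u hu
    by_cases hk : k + 2 ≤ 2 * D.e - 1
    · exact D.W_mono hk ((D.mem_W_succ _ _).2 ⟨u, hu, rfl⟩)
    · have := D.W_drop (k+1) u hu (D.top_mem _ (by omega) u hu)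
      obtain ⟨u', hu', h⟩ := (D.mem_W_succ _ _).1 this
      rw [← h]; exact ih u' hu'

theorem W_top (n : ℕ) (hn : 2 * D.e - 1 ≤ n) : D.W n = ⊤ := by
  rw [eq_top_iff]
  refine le_trans ?_ (D.W_mono hn)
  rintro v -
  obtain ⟨u, rfl⟩ := D.π_surj v
  rw [← sum_homogeneousComponent u, map_sum]
  exact Submodule.sum_mem _ fun i _ => D.W_hom i _ (homogeneousComponent_isHomogeneous _ _)

instance : FiniteDimensional ℂ D.V := by
  have : FiniteDimensional ℂ (homogeneousSubmodule (Fin 3) ℂ (2 * D.e - 1)) :=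
    Module.Finite.iff_fg.2 (homogeneousSubmodule_fg _ _ _)
  have h := D.W_top (2 * D.e - 1 + 1) (by omega)
  have h2 : FiniteDimensional ℂ (D.W (2 * D.e - 1 + 1)) := 
    inferInstanceAs (FiniteDimensional ℂ ((homogeneousSubmodule (Fin 3) ℂ (2 * D.e - 1)).map D.π.toLinearMap))
  rw [h] at h2
  exact Module.Finite.of_surjective (Submodule.topEquiv.toLinearMap) Submodule.topEquiv.surjective

theorem W_mul (n m N : ℕ) (h : n + m ≤ N + 1) (a b : D.V) (ha : a ∈ D.W n) (hb : b ∈ D.W m) :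
    a * b ∈ D.W N := by
  rcases n with _ | n
  · rw [mem_W_zero] at ha; rw [ha, zero_mul]; exact Submodule.zero_mem _
  rcases m with _ | m
  · rw [mem_W_zero] at hb; rw [hb, mul_zero]; exact Submodule.zero_mem _
  obtain ⟨u, hu, rfl⟩ := (D.mem_W_succ _ _).1 ha
  obtain ⟨v, hv, rfl⟩ := (D.mem_W_succ _ _).1 hb
  apply D.W_mono (show n + m + 1 ≤ N by omega)
  exact (D.mem_W_succ _ _).2 ⟨u * v, hu.mul hv, map_mul _ _ _⟩

theorem exists_ρ : ∃ ρ : D.V →ₗ[ℂ] ℂ, ∀ v, ρ v = 0 ↔ v ∈ D.W (2 * D.e - 2) := by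
  obtain ⟨w0, hw0, hw⟩ := nf_bin_sub _ _ D.e D.he (D.hψ _ _ D.hg1) (D.hψ _ _ D.hg2) D.hrel
  have he := D.he
  have key : ∀ v : D.V, ∃ c : ℂ, v - c • D.π (D.ι w0) ∈ D.W (2 * D.e - 2) := by
    intro v
    have hv : v ∈ D.W (2 * D.e - 2 + 1) := by rw [D.W_top _ (by omega)]; trivial
    obtain ⟨u, hu, rfl⟩ := (D.mem_W_succ _ _).1 hv
    obtain ⟨c, hc⟩ := hw (D.ψ u) (D.hψ _ _ hu)
    refine ⟨c, ?_⟩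
    rw [← map_smul, ← map_sub]
    apply D.W_drop
    · exact hu.sub ((homogeneousSubmodule (Fin 3) ℂ _).smul_mem c (D.hι _ _ hw0))
    · rw [map_sub, map_smul, D.hψι]; exact hc
  by_cases h0 : D.π (D.ι w0) ∈ D.W (2 * D.e - 2)
  · refine ⟨0, fun v => ⟨fun _ => ?_, fun _ => rfl⟩⟩
    obtain ⟨c, hc⟩ := key v
    simpa using Submodule.add_mem _ hc (Submodule.smul_mem _ c h0)
  · obtain ⟨ρ, h1, h2⟩ := Submodule.exists_le_ker_of_notMem h0
    refine ⟨ρ, fun v => ⟨fun hv => ?_, fun hv => h2 hv⟩⟩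
    obtain ⟨c, hc⟩ := key v
    have h3 : ρ (v - c • D.π (D.ι w0)) = 0 := h2 hc
    rw [map_sub, map_smul, hv, zero_sub, neg_eq_zero, smul_eq_mul] at h3
    have : c = 0 := (mul_eq_zero.1 h3).resolve_right h1
    rw [this] at hc; simpa using hc

def ρ : D.V →ₗ[ℂ] ℂ := D.exists_ρ.choose
theorem hρ (v : D.V) : D.ρ v = 0 ↔ v ∈ D.W (2 * D.e - 2) := D.exists_ρ.choose_spec v

theorem perp_aux (n : ℕ) (v : D.V) (h : ∀ b ∈ D.W n, D.ρ (b * v) = 0) (m : ℕ) (hm : m ≤ 2 * D.e - 1)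
    (hv : v ∈ D.W m) : v ∈ D.W (2 * D.e - 1 - n) := by
  have he := D.he
  induction m with
  | zero => exact D.W_mono (Nat.zero_le _) hv
  | succ m ih =>
    by_cases hmn : m + 1 ≤ 2 * D.e - 1 - n
    · exact D.W_mono hmn hv
    · obtain ⟨u, hu, rfl⟩ := (D.mem_W_succ _ _).1 hv
      by_cases hG : D.ψ u ∈ D.G
      · exact ih (by omega) (D.W_drop _ _ hu hG)
      · exfalso
        obtain ⟨w, hw, hw'⟩ := nf_bin_pair _ _ D.e D.he (D.hψ _ _ D.hg1) (D.hψ _ _ D.hg2) D.hrel m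
          (2 * D.e - 2 - m) (by omega) (D.ψ u) (D.hψ _ _ hu) hG
        have h1 : D.π (D.ι w) ∈ D.W n :=
          D.W_mono (show 2 * D.e - 2 - m + 1 ≤ n by omega) ((D.mem_W_succ _ _).2 ⟨_, D.hι _ _ hw, rfl⟩)
        have h2 := (D.hρ _).1 (h _ h1)
        obtain ⟨k, hk⟩ : ∃ k, 2 * D.e - 2 = k + 1 := ⟨2 * D.e - 3, by omega⟩
        rw [hk] at h2
        obtain ⟨c, hc, hc'⟩ := (D.mem_W_succ _ _).1 h2
        have h3 : u * D.ι w - D.l * c ∈ D.A := by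
          refine D.F1 _ (k + 1) (IsHomogeneous.sub ?_ ?_) ?_
          · rw [← hk, show 2 * D.e - 2 = m + (2 * D.e - 2 - m) by omega]
            exact hu.mul (D.hι _ _ hw)
          · rw [add_comm]; exact D.hl.mul hc
          · rw [← π_eq_zero, map_sub, map_mul, map_mul, π_l, hc']; ring
        apply hw'
        have := D.ψA _ h3
        rwa [map_sub, map_mul, map_mul, D.hψι, D.hψl, zero_mul, sub_zero] at this

theorem perp (n : ℕ) (v : D.V) : (∀ b ∈ D.W n, D.ρ (b * v) = 0) ↔ v ∈ D.W (2 * D.e - 1 - n) := by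
  have he := D.he
  constructor
  · intro h
    exact D.perp_aux n v h (2 * D.e - 1) le_rfl (by rw [D.W_top _ le_rfl]; trivial)
  · intro hv b hb
    rw [hρ]
    by_cases hn : n ≤ 2 * D.e - 1
    · exact D.W_mul n (2 * D.e - 1 - n) _ (by omega) b v hb hv
    · rw [show 2 * D.e - 1 - n = 0 by omega, mem_W_zero] at hv
      rw [hv, mul_zero]; exact Submodule.zero_mem _

def B : LinearMap.BilinForm ℂ D.V := (LinearMap.mul ℂ D.V).compr₂ D.ρ
theorem B_apply (a b : D.V) : D.B a b = D.ρ (a * b) := rfl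

theorem B_eq_zero (v : D.V) (h : ∀ b, D.ρ (b * v) = 0) : v = 0 := by
  have := (D.perp (2 * D.e - 1) v).1 fun b _ => h b
  rwa [Nat.sub_self, mem_W_zero] at this

theorem B_nondeg : D.B.Nondegenerate := by
  constructor
  · intro m hm
    exact D.B_eq_zero m fun b => by rw [mul_comm]; exact hm b
  · intro m hm
    exact D.B_eq_zero m fun b => hm b

def hm : D.V →ₗ[ℂ] D.V := LinearMap.mulLeft ℂ (D.π D.h)
theorem hm_apply (v : D.V) : D.hm v = D.π D.h * v := rfl

theorem ortho_W (n : ℕ) : D.B.orthogonal (D.W n) = D.W (2 * D.e - 1 - n) := by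
  ext v
  rw [LinearMap.BilinForm.mem_orthogonal_iff, ← perp]; rfl

theorem ortho_sup (n : ℕ) : D.B.orthogonal (D.W n ⊔ LinearMap.range D.hm) =
    D.W (2 * D.e - 1 - n) ⊓ LinearMap.ker D.hm := by
  ext v
  rw [Submodule.mem_inf, LinearMap.BilinForm.mem_orthogonal_iff, ← perp, LinearMap.mem_ker]
  constructor
  · intro h
    refine ⟨fun b hb => h b (Submodule.mem_sup_left hb), D.B_eq_zero _ fun b => ?_⟩
    have := h (D.hm b) (Submodule.mem_sup_right ⟨b, rfl⟩)
    rw [B_apply] at this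
    rw [← this]; congr 1; rw [hm_apply, hm_apply]; ring
  · rintro ⟨h1, h2⟩ b hb
    obtain ⟨x, hx, y, ⟨y, rfl⟩, rfl⟩ := Submodule.mem_sup.1 hb
    rw [map_add, LinearMap.add_apply, B_apply, B_apply, h1 x hx, hm_apply]
    rw [show D.π D.h * y * v = y * D.hm v by rw [hm_apply]; ring, h2]; simp

theorem count (n : ℕ) : Module.finrank ℂ ↥(D.W n ⊓ LinearMap.range D.hm)
    + Module.finrank ℂ ((D.W (2 * D.e - 1 - n)).map D.hm) = Module.finrank ℂ (LinearMap.range D.hm) := by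
  have h1 := Submodule.finrank_sup_add_finrank_inf_eq (D.W n) (LinearMap.range D.hm)
  have h2 := LinearMap.BilinForm.finrank_orthogonal D.B_nondeg (D.W n)
  have h3 := LinearMap.BilinForm.finrank_orthogonal D.B_nondeg (D.W n ⊔ LinearMap.range D.hm)
  rw [ortho_W] at h2
  rw [ortho_sup] at h3
  have h4 := nf_finrank_map D.hm (D.W (2 * D.e - 1 - n))
  have h5 := Submodule.finrank_le (D.W n)
  have h6 := Submodule.finrank_le (D.W n ⊔ LinearMap.range D.hm)
  omega

end NFD

namespace NFD
variable (D : NFD)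

/-- homogenization -/
theorem homog (q : S) : ∃ N0, ∀ N, N0 ≤ N → ∃ q' : S, q'.IsHomogeneous N ∧ D.π q' = D.π q := by
  refine ⟨q.totalDegree, fun N hN => ⟨∑ i ∈ Finset.range (q.totalDegree + 1),
    D.l ^ (N - i) * homogeneousComponent i q, ?_, ?_⟩⟩
  · refine IsHomogeneous.sum _ _ _ fun i hi => ?_
    have h1 := (D.hl.pow (N - i)).mul (homogeneousComponent_isHomogeneous i q)
    have : 1 * (N - i) + i = N := by simp at hi; omega
    rwa [this] at h1
  · conv_rhs => rw [← sum_homogeneousComponent q]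
    rw [map_sum, map_sum]
    refine Finset.sum_congr rfl fun i _ => ?_
    rw [map_mul, map_pow, π_l, one_pow, one_mul]

theorem π_J (u : S) (hu : u ∈ D.J) : ∃ c, D.π u = D.hm (D.π c) := by
  obtain ⟨a, c, ha, rfl⟩ := (D.memJ u).1 hu
  exact ⟨c, by rw [map_add, map_mul, D.π_A a ha, zero_add, hm_apply, mul_comm]⟩

theorem F2 (f : S) (hJ : Jf f = D.J) (i : ℕ) (u : S) (hu : u.IsHomogeneous i) :
    u ∈ Isat f ↔ D.π u ∈ LinearMap.range D.hm := by
  rw [D.sat f hJ]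
  constructor
  · rintro ⟨n, hn⟩
    obtain ⟨c, hc⟩ := D.π_J _ hn
    rw [map_mul, map_pow, π_l, one_pow, one_mul] at hc
    rw [hc]; exact ⟨_, rfl⟩
  · rintro ⟨v, hv⟩
    obtain ⟨q, rfl⟩ := D.π_surj v
    obtain ⟨N0, hN⟩ := D.homog q
    obtain ⟨q', hq', hq⟩ := hN (N0 + i) (by omega)
    refine ⟨N0 + D.e, ?_⟩
    have : D.l ^ (N0 + D.e) * u - q' * D.h ∈ D.A := by
      refine D.F1 _ (N0 + i + D.e) (IsHomogeneous.sub ?_ (hq'.mul D.hh)) ?_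
      · have := (D.hl.pow (N0 + D.e)).mul hu
        rwa [show 1 * (N0 + D.e) + i = N0 + i + D.e by ring] at this
      · rw [← π_eq_zero, map_sub, map_mul, map_mul, map_pow, π_l, hq, ← hv, hm_apply]; ring
    exact (D.memJ _).2 ⟨_, q', this, by ring⟩

theorem J_hom (u : S) (i : ℕ) (hu : u.IsHomogeneous i) (h : u ∈ D.J) :
    ∃ c, D.π u = D.hm c ∧ c ∈ D.W (i + 1 - D.e) := by
  have hr : Set.range ![D.g1, D.g2, D.h] = {D.g1, D.g2, D.h} := by
    ext x; simp; tauto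
  obtain ⟨a, ha, hb, hc⟩ := nf_mem_span_hom ![D.g1, D.g2, D.h] D.e i
    (by intro i; fin_cases i; exacts [D.hg1, D.hg2, D.hh]) u (by rw [hr]; exact h)
  rw [homogeneousComponent_of_mem hu, if_pos rfl] at ha
  simp only [Fin.sum_univ_three, Matrix.cons_val] at ha
  have hA : a 0 * D.g1 + a 1 * D.g2 ∈ D.A := (D.memA _).2 ⟨_, _, rfl⟩
  refine ⟨D.π (a 2), ?_, ?_⟩
  · rw [ha, map_add, D.π_A _ hA, zero_add, map_mul, hm_apply, mul_comm]
  · rcases le_or_gt D.e i with h | h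
    · rw [show i + 1 - D.e = i - D.e + 1 by omega]
      exact (D.mem_W_succ _ _).2 ⟨_, hb h 2, rfl⟩
    · rw [hc h 2, map_zero]; exact Submodule.zero_mem _

theorem F3 (i : ℕ) (u : S) (hu : u.IsHomogeneous i) (c : D.V) (hc : c ∈ D.W (i + 1 - D.e))
    (h : D.π u = D.hm c) : u ∈ D.J := by
  rcases le_or_gt D.e i with h1 | h1
  · rw [show i + 1 - D.e = i - D.e + 1 by omega] at hc
    obtain ⟨q, hq, rfl⟩ := (D.mem_W_succ _ _).1 hc
    have : u - q * D.h ∈ D.A := by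
      refine D.F1 _ i (hu.sub ?_) ?_
      · have := hq.mul D.hh
        rwa [Nat.sub_add_cancel h1] at this
      · rw [← π_eq_zero, map_sub, map_mul, h, hm_apply]; ring
    exact (D.memJ _).2 ⟨_, q, this, by ring⟩
  · rw [show i + 1 - D.e = 0 by omega, mem_W_zero] at hc
    rw [hc, map_zero, π_eq_zero] at h
    exact D.A_le_J (D.F1 u i hu h)

theorem J_W (i : ℕ) (c : D.V) (hc : c ∈ D.W (i + 1 - D.e)) :
    ∃ u : S, u.IsHomogeneous i ∧ u ∈ D.J ∧ D.π u = D.hm c := by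
  rcases le_or_gt D.e i with h1 | h1
  · rw [show i + 1 - D.e = i - D.e + 1 by omega] at hc
    obtain ⟨q, hq, rfl⟩ := (D.mem_W_succ _ _).1 hc
    refine ⟨q * D.h, ?_, (D.memJ _).2 ⟨0, q, D.A.zero_mem, by ring⟩, ?_⟩
    · have := hq.mul D.hh
      rwa [Nat.sub_add_cancel h1] at this
    · rw [map_mul, hm_apply, mul_comm]
  · rw [show i + 1 - D.e = 0 by omega, mem_W_zero] at hc
    exact ⟨0, isHomogeneous_zero _ _ _, D.J.zero_mem, by rw [hc]; simp⟩

theorem ndim_add (f : S) (hJ : Jf f = D.J) (i : ℕ) :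
    ndim f i + Module.finrank ℂ ((D.W (i + 1 - D.e)).map D.hm)
      = Module.finrank ℂ ↥(D.W (i + 1) ⊓ LinearMap.range D.hm) := by
  let T2 : Submodule ℂ S := (Isat f).restrictScalars ℂ ⊓ Sgr i
  let T1 : Submodule ℂ S := (Jf f).restrictScalars ℂ ⊓ Sgr i
  have hfd : FiniteDimensional ℂ (Sgr i) := Module.Finite.iff_fg.2 (homogeneousSubmodule_fg _ _ _)
  have : FiniteDimensional ℂ T2 := Submodule.finiteDimensional_of_le inf_le_right
  have : FiniteDimensional ℂ T1 := Submodule.finiteDimensional_of_le inf_le_right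
  have hle : Jf f ≤ Isat f := by
    intro u hu
    rw [D.sat f hJ]; exact ⟨0, by rw [pow_zero, one_mul, ← hJ]; exact hu⟩
  have a1 := nf_finrank_map (quotC f) T2
  have a2 := nf_finrank_map D.π.toLinearMap T2
  have a3 := nf_finrank_map D.π.toLinearMap T1
  have b1 : T2 ⊓ LinearMap.ker (quotC f) = T1 := by
    have hk : LinearMap.ker (quotC f) = (Jf f).restrictScalars ℂ := by
      ext u
      rw [LinearMap.mem_ker]
      exact Submodule.Quotient.mk_eq_zero _
    rw [hk]
    ext u
    constructor
    · rintro ⟨⟨h1, h2⟩, h3⟩; exact ⟨h3, h2⟩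
    · rintro ⟨h1, h2⟩; exact ⟨⟨hle h1, h2⟩, h1⟩
  have b2 : T2 ⊓ LinearMap.ker D.π.toLinearMap = T1 ⊓ LinearMap.ker D.π.toLinearMap := by
    ext u
    constructor
    · rintro ⟨⟨h1, h2⟩, h3⟩
      refine ⟨⟨?_, h2⟩, h3⟩
      have : u ∈ D.J := D.A_le_J (D.F1 u i h2 ((D.π_eq_zero u).1 h3))
      rw [← hJ] at this; exact this
    · rintro ⟨⟨h1, h2⟩, h3⟩; exact ⟨⟨hle h1, h2⟩, h3⟩
  have b3 : T2.map D.π.toLinearMap = D.W (i + 1) ⊓ LinearMap.range D.hm := by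
    ext v
    constructor
    · rintro ⟨u, ⟨h1, h2⟩, rfl⟩
      exact ⟨(D.mem_W_succ _ _).2 ⟨u, h2, rfl⟩, (D.F2 f hJ i u h2).1 h1⟩
    · rintro ⟨h1, h2⟩
      obtain ⟨u, hu, rfl⟩ := (D.mem_W_succ _ _).1 h1
      exact ⟨u, ⟨(D.F2 f hJ i u hu).2 h2, hu⟩, rfl⟩
  have b4 : T1.map D.π.toLinearMap = (D.W (i + 1 - D.e)).map D.hm := by
    ext v
    constructor
    · rintro ⟨u, ⟨h1, h2⟩, rfl⟩
      have h1' : u ∈ D.J := by rw [← hJ]; exact h1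
      obtain ⟨c, hc, hc'⟩ := D.J_hom u i h2 h1'
      exact ⟨c, hc', hc.symm⟩
    · rintro ⟨c, hc, rfl⟩
      obtain ⟨u, hu, huJ, h⟩ := D.J_W i c hc
      rw [← hJ] at huJ
      exact ⟨u, ⟨huJ, hu⟩, h⟩
  rw [b1] at a1
  rw [b2, b3] at a2
  rw [b4] at a3
  have : ndim f i = Module.finrank ℂ (T2.map (quotC f)) := rfl
  omega

theorem ndim_symm (f : S) (hJ : Jf f = D.J) (i : ℕ) (hi : i ≤ 3 * D.e - 3) :
    ndim f i = ndim f (3 * D.e - 3 - i) := by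
  have he := D.he
  have h1 := D.ndim_add f hJ i
  have h2 := D.ndim_add f hJ (3 * D.e - 3 - i)
  have h3 := D.count (i + 1)
  have h4 := D.count (3 * D.e - 3 - i + 1)
  rw [show 2 * D.e - 1 - (3 * D.e - 3 - i + 1) = i + 1 - D.e by omega] at h4
  rw [show 3 * D.e - 3 - i + 1 - D.e = 2 * D.e - 1 - (i + 1) by omega] at h2
  omega

theorem ndim_zero (f : S) (hJ : Jf f = D.J) (i : ℕ) (hi : 3 * D.e - 3 < i) : ndim f i = 0 := by
  have he := D.he
  have h1 := D.ndim_add f hJ i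
  rw [D.W_top (i + 1 - D.e) (by omega), D.W_top (i + 1) (by omega), Submodule.map_top, top_inf_eq] at h1
  omega

end NFD

abbrev NR : Type := MvPolynomial (Fin 4) ℂ

def nfφ : S →ₐ[ℂ] NR := aeval ![X 0, X 1, X 2 * X 0 + X 3 * X 1]

theorem nfφ_X0 : nfφ (X 0) = X 0 := by simp [nfφ]
theorem nfφ_X1 : nfφ (X 1) = X 1 := by simp [nfφ]
theorem nfφ_X2 : nfφ (X 2) = X 2 * X 0 + X 3 * X 1 := by simp [nfφ]
theorem nfφ_C (c : ℂ) : nfφ (C c) = C c := by simp [nfφ]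

def nfD : Derivation ℂ NR NR := mkDerivation ℂ ![0, 0, X 1, -X 0]

theorem nfD_X0 : nfD (X 0) = 0 := by simp [nfD, mkDerivation_X]
theorem nfD_X1 : nfD (X 1) = 0 := by simp [nfD, mkDerivation_X]
theorem nfD_X2 : nfD (X 2) = X 1 := by simp [nfD, mkDerivation_X]
theorem nfD_X3 : nfD (X 3) = -X 0 := by simp [nfD, mkDerivation_X]
theorem nfD_C (c : ℂ) : nfD (C c) = 0 := by simp [nfD]

theorem nfD_mul (a b : NR) : nfD (a * b) = a * nfD b + b * nfD a := by
  rw [Derivation.leibniz]; rfl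

theorem nfD_φ (u : S) : nfD (nfφ u) = 0 := by
  induction u using MvPolynomial.induction_on with
  | C a => rw [nfφ_C, nfD_C]
  | add p q hp hq => rw [map_add, map_add, hp, hq, add_zero]
  | mul_X p i hp =>
    rw [map_mul, nfD_mul, hp, mul_zero, add_zero]
    fin_cases i
    · simp [nfφ_X0, nfD_X0]
    · simp [nfφ_X1, nfD_X1]
    · simp only [Fin.reduceFinMk, nfφ_X2, map_add, nfD_mul, nfD_X0, nfD_X1, nfD_X2, nfD_X3]; ring

def nfE : NR →+* Polynomial NR :=
  eval₂Hom (Polynomial.C.comp C) ![Polynomial.C (X 0), Polynomial.C (X 1),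
    Polynomial.C (X 2) + Polynomial.X * Polynomial.C (X 1),
    Polynomial.C (X 3) - Polynomial.X * Polynomial.C (X 0)]

theorem nfE_C (c : ℂ) : nfE (C c) = Polynomial.C (C c) := by simp [nfE]
theorem nfE_X0 : nfE (X 0) = Polynomial.C (X 0) := by simp [nfE]
theorem nfE_X1 : nfE (X 1) = Polynomial.C (X 1) := by simp [nfE]
theorem nfE_X2 : nfE (X 2) = Polynomial.C (X 2) + Polynomial.X * Polynomial.C (X 1) := by simp [nfE]
theorem nfE_X3 : nfE (X 3) = Polynomial.C (X 3) - Polynomial.X * Polynomial.C (X 0) := by simp [nfE]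

theorem nfE_eval0 (a : NR) : (nfE a).eval 0 = a := by
  have : (Polynomial.evalRingHom (0 : NR)).comp nfE = RingHom.id _ := by
    apply MvPolynomial.ringHom_ext
    · intro r; simp [nfE_C]
    · intro i
      fin_cases i <;> simp [nfE_X0, nfE_X1, nfE_X2, nfE_X3]
  exact DFunLike.congr_fun this a

theorem nfE_inj : Function.Injective nfE := fun a b h => by
  rw [← nfE_eval0 a, h, nfE_eval0]

theorem nfE_der (a : NR) : Polynomial.derivative (nfE a) = nfE (nfD a) := by
  induction a using MvPolynomial.induction_on with
  | C a => rw [nfE_C, nfD_C]; simp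
  | add p q hp hq => simp only [map_add, hp, hq]
  | mul_X p i hp =>
    rw [map_mul, nfD_mul, Polynomial.derivative_mul, hp, map_add, map_mul, map_mul]
    fin_cases i
    · simp only [Fin.reduceFinMk, Fin.zero_eta, nfE_X0, nfD_X0, map_zero, Polynomial.derivative_C]; ring
    · simp only [Fin.reduceFinMk, Fin.mk_one, nfE_X1, nfD_X1, map_zero, Polynomial.derivative_C]; ring
    · simp only [Fin.reduceFinMk, nfE_X2, nfD_X2, nfE_X1, Polynomial.derivative_C, Polynomial.derivative_add,
        Polynomial.derivative_mul, Polynomial.derivative_X]; ring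
    · simp only [Fin.reduceFinMk, nfE_X3, nfD_X3, nfE_X0, Polynomial.derivative_C, Polynomial.derivative_sub,
        Polynomial.derivative_mul, Polynomial.derivative_X, map_neg]; ring

theorem nfD_iff (a : NR) : nfD a = 0 ↔ (nfE a).natDegree = 0 := by
  constructor
  · intro h
    apply Polynomial.natDegree_eq_zero_of_derivative_eq_zero
    rw [nfE_der, h, map_zero]
  · intro h
    apply nfE_inj
    rw [← nfE_der, map_zero, Polynomial.eq_C_of_natDegree_eq_zero h, Polynomial.derivative_C]

theorem nfD_dvd (p q : NR) (h : p * q ≠ 0) (hD : nfD (p * q) = 0) : nfD p = 0 ∧ nfD q = 0 := by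
  rw [nfD_iff] at *
  rw [nfD_iff]
  have hp : nfE p ≠ 0 := fun h1 => left_ne_zero_of_mul h (nfE_inj (by rw [h1, map_zero]))
  have hq : nfE q ≠ 0 := fun h1 => right_ne_zero_of_mul h (nfE_inj (by rw [h1, map_zero]))
  rw [map_mul, Polynomial.natDegree_mul hp hq] at hD
  omega

theorem nfD_eigen (a c : NR) (h : nfD a = c * a) : nfD a = 0 := by
  by_contra h0
  have hne : nfE c * nfE a ≠ 0 := by
    rw [← map_mul, ← h]; exact fun h1 => h0 (nfE_inj (by rw [h1, map_zero]))
  have h1 := congrArg Polynomial.natDegree (nfE_der a)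
  rw [h, map_mul, Polynomial.natDegree_mul (left_ne_zero_of_mul hne) (right_ne_zero_of_mul hne)] at h1
  have h2 : (nfE a).natDegree ≠ 0 := fun h2 => h0 ((nfD_iff a).2 h2)
  have h3 := Polynomial.natDegree_derivative_lt h2
  omega

theorem nf_x_dvd (b : S) (h : X 0 ∣ nfφ b) : X 0 ∣ b := by
  let χ : NR →ₐ[ℂ] FractionRing S := aeval ![0, algebraMap S _ (X 1), 0,
    algebraMap S _ (X 2) / algebraMap S _ (X 1)]
  let κ : S →ₐ[ℂ] S := aeval ![0, X 1, X 2]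
  have hne : algebraMap S (FractionRing S) (X 1) ≠ 0 := by
    intro h1
    exact (X_ne_zero 1) (IsFractionRing.injective S (FractionRing S) (by rw [h1, map_zero]))
  have e1 : ∀ u, χ (nfφ u) = algebraMap S (FractionRing S) (κ u) := by
    intro u
    have : χ.comp nfφ = (IsScalarTower.toAlgHom ℂ S (FractionRing S)).comp κ := by
      apply MvPolynomial.algHom_ext
      intro i
      fin_cases i
      · simp [χ, nfφ_X0, κ]
      · simp [χ, nfφ_X1, κ]
      · simp [χ, nfφ_X2, κ, hne]
    exact DFunLike.congr_fun this u
  have e2 : ∀ u, X 0 ∣ u - κ u := by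
    intro u
    induction u using MvPolynomial.induction_on with
    | C a => simp [κ]
    | add p q hp hq =>
      rw [map_add]; convert dvd_add hp hq using 1; ring
    | mul_X p i hp =>
      have : X 0 ∣ X i - κ (X i) := by fin_cases i <;> simp [κ]
      rw [map_mul]
      convert dvd_add (hp.mul_right (X i)) (this.mul_left (κ p)) using 1; ring
  have e3 : κ b = 0 := by
    apply IsFractionRing.injective S (FractionRing S)
    rw [← e1, map_zero]
    obtain ⟨c, hc⟩ := h
    rw [hc, map_mul]; simp [χ]
  have := e2 b
  rwa [e3, sub_zero] at this

theorem nfφ_inj : Function.Injective nfφ := by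
  let χ : NR →ₐ[ℂ] FractionRing S := aeval ![algebraMap S _ (X 0), algebraMap S _ (X 1),
    algebraMap S _ (X 2) / algebraMap S _ (X 0), 0]
  have hne : algebraMap S (FractionRing S) (X 0) ≠ 0 := by
    intro h1
    exact (X_ne_zero 0) (IsFractionRing.injective S (FractionRing S) (by rw [h1, map_zero]))
  have e1 : ∀ u, χ (nfφ u) = algebraMap S (FractionRing S) u := by
    intro u
    have : χ.comp nfφ = (IsScalarTower.toAlgHom ℂ S (FractionRing S)) := by
      apply MvPolynomial.algHom_ext
      intro i
      fin_cases i
      · simp [χ, nfφ_X0]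
      · simp [χ, nfφ_X1]
      · simp [χ, nfφ_X2, hne]
    exact DFunLike.congr_fun this u
  intro a b h
  apply IsFractionRing.injective S (FractionRing S)
  rw [← e1, h, e1]

theorem nf_ker (a : NR) (h : nfD a = 0) : ∃ b, a = nfφ b := by
  have hE : nfE a = Polynomial.C a := by
    have := Polynomial.eq_C_of_natDegree_eq_zero ((nfD_iff a).1 h)
    have h2 := nfE_eval0 a
    rw [this, Polynomial.eval_C] at h2
    rw [this, h2]
  let g := algebraMap NR (FractionRing NR)
  have ginj : Function.Injective g := IsFractionRing.injective NR (FractionRing NR)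
  have hne : g (X 0) ≠ 0 := by
    intro h1
    exact (X_ne_zero 0) (ginj (by rw [h1, map_zero]))
  let ev : NR →+* FractionRing NR := (Polynomial.eval₂RingHom g (g (X 3) / g (X 0))).comp nfE
  have key : ∀ a, ∃ n b, g (X 0) ^ n * ev a = g (nfφ b) := by
    intro a
    induction a using MvPolynomial.induction_on with
    | C c => exact ⟨0, C c, by simp [ev, nfE_C, nfφ_C]⟩
    | add p q hp hq =>
      obtain ⟨n, b, hb⟩ := hp
      obtain ⟨m, c, hc⟩ := hq
      refine ⟨n + m, X 0 ^ m * b + X 0 ^ n * c, ?_⟩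
      simp only [map_add, map_mul, map_pow, nfφ_X0, ← hb, ← hc]; ring
    | mul_X p i hp =>
      obtain ⟨n, b, hb⟩ := hp
      fin_cases i
      · refine ⟨n, b * X 0, ?_⟩
        simp only [map_mul, nfφ_X0, ← hb]
        simp [ev, nfE_X0]; ring
      · refine ⟨n, b * X 1, ?_⟩
        simp only [map_mul, nfφ_X1, ← hb]
        simp [ev, nfE_X1]; ring
      · refine ⟨n + 1, b * X 2, ?_⟩
        simp only [map_mul, nfφ_X2, ← hb, map_add]
        simp [ev, nfE_X2]; field_simp; ring
      · refine ⟨0, 0, ?_⟩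
        simp [ev, nfE_X3]; right; field_simp; simp
  obtain ⟨n, b, hb⟩ := key a
  have h1 : X 0 ^ n * a = nfφ b := by
    apply ginj
    rw [← hb, map_mul, map_pow]
    congr 1
    simp [ev, hE]
  clear hb
  induction n generalizing b with
  | zero => exact ⟨b, by simpa using h1⟩
  | succ n ih =>
    obtain ⟨c, rfl⟩ := nf_x_dvd b ⟨X 0 ^ n * a, by rw [← h1]; ring⟩
    apply ih c
    apply mul_left_cancel₀ (X_ne_zero (R := ℂ) (0 : Fin 4))
    rw [map_mul, nfφ_X0] at h1
    rw [← h1]; ring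

theorem nf_dvd_of_all (c : Fin 3 → NR) (hc : ∀ p, Prime p → (∀ j, p ∣ c j) → False) (a : NR) :
    a ≠ 0 → ∀ b, (∀ j, a ∣ b * c j) → a ∣ b := by
  induction a using UniqueFactorizationMonoid.induction_on_prime with
  | h₁ => intro h; exact absurd rfl h
  | h₂ x hx => intro _ b _; exact hx.dvd
  | h₃ a p ha hp ih =>
    intro h0 b hb
    have : ∃ j, ¬ p ∣ c j := by
      by_contra h; push Not at h; exact hc p hp h
    obtain ⟨j, hj⟩ := this
    have h1 : p ∣ b * c j := (Dvd.intro _ rfl).trans (hb j)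
    obtain ⟨b', rfl⟩ := (hp.dvd_or_dvd h1).resolve_right hj
    apply mul_dvd_mul_left
    apply ih ha
    intro j
    have := hb j
    rw [mul_assoc] at this
    exact (mul_dvd_mul_iff_left hp.ne_zero).1 this

theorem nf_vec (F P : Fin 3 → NR) (hF : ∀ p, Prime p → (∀ j, p ∣ F j) → False)
    (j0 : Fin 3) (h0 : F j0 ≠ 0) (h : ∀ i j, P i * F j = P j * F i) : ∃ g, ∀ i, P i = g * F i := by
  obtain ⟨g, hg⟩ := nf_dvd_of_all F hF (F j0) h0 (P j0) (fun j => ⟨P j, by rw [h j0 j]; ring⟩)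
  refine ⟨g, fun i => ?_⟩
  apply mul_left_cancel₀ h0
  have := h i j0
  rw [hg] at this
  linear_combination this

theorem nf_prim (B : Fin 3 → NR) (i0 : Fin 3) (h0 : B i0 ≠ 0) :
    ∃ (g : NR) (A : Fin 3 → NR), g ≠ 0 ∧ (∀ i, B i = g * A i) ∧
      (∀ p, Prime p → (∀ j, p ∣ A j) → False) := by
  obtain ⟨inst⟩ : Nonempty (NormalizedGCDMonoid NR) := inferInstance
  obtain ⟨A, hA, hA1⟩ := Finset.extract_gcd B (s := Finset.univ) ⟨0, Finset.mem_univ _⟩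
  refine ⟨Finset.univ.gcd B, A, ?_, fun i => hA i (Finset.mem_univ _), ?_⟩
  · intro h
    apply h0
    rw [hA i0 (Finset.mem_univ _), h, zero_mul]
  · intro p hp h
    have : p ∣ Finset.univ.gcd A := Finset.dvd_gcd (fun i _ => h i)
    rw [hA1] at this
    exact hp.not_isUnit (isUnit_of_dvd_one this)

theorem nf_noprime (F : Fin 3 → S) (hno : ∀ p, Prime p → (∀ i, p ∣ F i) → False)
    (j0 : Fin 3) (h0 : F j0 ≠ 0) : ∀ p, Prime p → (∀ j, p ∣ nfφ (F j)) → False := by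
  intro p hp h
  have hφ0 : ∀ a, nfφ a = 0 → a = 0 := fun a ha => nfφ_inj (by rw [ha, map_zero])
  have key : ∀ j q, nfφ (F j) = p * q → F j ≠ 0 → nfD p = 0 ∧ nfD q = 0 := by
    intro j q hq hj
    apply nfD_dvd
    · rw [← hq]; exact fun h => hj (hφ0 _ h)
    · rw [← hq, nfD_φ]
  have hDp : nfD p = 0 := by
    obtain ⟨q, hq⟩ := h j0
    exact (key j0 q hq h0).1
  obtain ⟨p', rfl⟩ := nf_ker p hDp
  have hdvd : ∀ j, p' ∣ F j := by
    intro j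
    by_cases hj : F j = 0
    · rw [hj]; exact dvd_zero _
    obtain ⟨q, hq⟩ := h j
    obtain ⟨q', rfl⟩ := nf_ker q (key j q hq hj).2
    exact ⟨q', nfφ_inj (by rw [hq, map_mul])⟩
  have hnu : ¬ IsUnit p' := fun hu => hp.not_isUnit (hu.map nfφ)
  have hn0 : p' ≠ 0 := by
    rintro rfl; exact hp.ne_zero (map_zero _)
  obtain ⟨r, hr, hrp⟩ := WfDvdMonoid.exists_irreducible_factor hnu hn0
  exact hno r hr.prime (fun i => hrp.trans (hdvd i))

def nfH : NR →+* Polynomial NR :=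
  eval₂Hom (Polynomial.C.comp C) ![Polynomial.C (X 0) * Polynomial.X,
    Polynomial.C (X 1) * Polynomial.X, Polynomial.C (X 2), Polynomial.C (X 3)]

theorem nfH_C (c : ℂ) : nfH (C c) = Polynomial.C (C c) := by simp [nfH]
theorem nfH_X0 : nfH (X 0) = Polynomial.C (X 0) * Polynomial.X := by simp [nfH]
theorem nfH_X1 : nfH (X 1) = Polynomial.C (X 1) * Polynomial.X := by simp [nfH]
theorem nfH_X2 : nfH (X 2) = Polynomial.C (X 2) := by simp [nfH]
theorem nfH_X3 : nfH (X 3) = Polynomial.C (X 3) := by simp [nfH]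

theorem nfH_eval1 (a : NR) : (nfH a).eval 1 = a := by
  have : (Polynomial.evalRingHom (1 : NR)).comp nfH = RingHom.id _ := by
    apply MvPolynomial.ringHom_ext
    · intro r; simp [nfH_C]
    · intro i
      fin_cases i <;> simp [nfH_X0, nfH_X1, nfH_X2, nfH_X3]
  exact DFunLike.congr_fun this a

theorem nfH_inj : Function.Injective nfH := fun a b h => by
  rw [← nfH_eval1 a, h, nfH_eval1]

theorem nfH_ne {a : NR} (h : a ≠ 0) : nfH a ≠ 0 := fun h1 => h (nfH_inj (by rw [h1, map_zero]))

theorem nfH_φX (i : Fin 3) : nfH (nfφ (X i)) = Polynomial.C (nfφ (X i)) * Polynomial.X := by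
  fin_cases i
  · simp [nfφ_X0, nfH_X0]
  · simp [nfφ_X1, nfH_X1]
  · simp only [Fin.reduceFinMk, nfφ_X2, map_add, map_mul, nfH_X0, nfH_X1, nfH_X2, nfH_X3]; ring

theorem nfH_φ (a : S) (k : ℕ) (ha : a.IsHomogeneous k) :
    nfH (nfφ a) = Polynomial.C (nfφ a) * Polynomial.X ^ k := by
  conv_lhs => rw [a.as_sum]
  conv_rhs => rw [a.as_sum]
  simp only [map_sum, Finset.sum_mul]
  apply Finset.sum_congr rfl
  intro m hm
  have hd : m.degree = k := by
    have := ha (mem_support_iff.1 hm)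
    rwa [Finsupp.degree_eq_weight_one]
  rw [Finsupp.degree_eq_sum, Fin.sum_univ_three] at hd
  rw [monomial_eq, Finsupp.prod_fintype _ _ (fun _ => pow_zero _), Fin.prod_univ_three]
  simp only [map_mul, map_pow, nfH_φX, nfφ_C, nfH_C]
  rw [← hd]; ring

theorem nfH_D (a : NR) : (nfH (nfD a)).coeff 0 = 0 ∧
    ∀ n, (nfH (nfD a)).coeff (n + 1) = nfD ((nfH a).coeff n) := by
  induction a using MvPolynomial.induction_on with
  | C a =>
    rw [nfD_C, nfH_C]
    refine ⟨by simp, fun n => ?_⟩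
    rw [Polynomial.coeff_C]
    split_ifs
    · simp [nfD_C]
    · simp
  | add p q hp hq =>
    refine ⟨?_, fun n => ?_⟩
    · simp only [map_add, Polynomial.coeff_add, hp.1, hq.1, add_zero]
    · simp only [map_add, Polynomial.coeff_add, hp.2, hq.2]
  | mul_X p i hp =>
    rw [nfD_mul, map_add, map_mul, map_mul, map_mul]
    fin_cases i
    · simp only [Fin.zero_eta, nfD_X0, map_zero, mul_zero, zero_add, nfH_X0]
      refine ⟨by simp, fun n => ?_⟩
      rw [show Polynomial.C (X 0) * Polynomial.X * nfH (nfD p) =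
        Polynomial.C (X 0) * (nfH (nfD p) * Polynomial.X) by ring,
        show nfH p * (Polynomial.C (X 0) * Polynomial.X) =
        Polynomial.C (X 0) * (nfH p * Polynomial.X) by ring]
      rw [Polynomial.coeff_C_mul, Polynomial.coeff_C_mul, Polynomial.coeff_mul_X, nfD_mul, nfD_X0]
      cases n with
      | zero => simp [hp.1]
      | succ n => rw [Polynomial.coeff_mul_X, hp.2]; ring
    · simp only [Fin.mk_one, nfD_X1, map_zero, mul_zero, zero_add, nfH_X1]
      refine ⟨by simp, fun n => ?_⟩
      rw [show Polynomial.C (X 1) * Polynomial.X * nfH (nfD p) =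
        Polynomial.C (X 1) * (nfH (nfD p) * Polynomial.X) by ring,
        show nfH p * (Polynomial.C (X 1) * Polynomial.X) =
        Polynomial.C (X 1) * (nfH p * Polynomial.X) by ring]
      rw [Polynomial.coeff_C_mul, Polynomial.coeff_C_mul, Polynomial.coeff_mul_X, nfD_mul, nfD_X1]
      cases n with
      | zero => simp [hp.1]
      | succ n => rw [Polynomial.coeff_mul_X, hp.2]; ring
    · simp only [Fin.reduceFinMk, nfD_X2, nfH_X1, nfH_X2]
      refine ⟨by simp [hp.1], fun n => ?_⟩
      rw [← mul_assoc, Polynomial.coeff_add, Polynomial.coeff_mul_X, Polynomial.coeff_C_mul,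
        Polynomial.coeff_mul_C, Polynomial.coeff_mul_C, hp.2, nfD_mul, nfD_X2]
    · have hneg : nfH (nfD (X 3)) = Polynomial.C (-X 0 : NR) * Polynomial.X := by
        rw [nfD_X3, map_neg, nfH_X0, Polynomial.C_neg]; ring
      simp only [Fin.reduceFinMk, hneg, nfH_X3]
      refine ⟨by simp [hp.1], fun n => ?_⟩
      rw [← mul_assoc, Polynomial.coeff_add, Polynomial.coeff_mul_X, Polynomial.coeff_C_mul,
        Polynomial.coeff_mul_C, Polynomial.coeff_mul_C, hp.2, nfD_mul, nfD_X3]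

theorem nfH_D_deg (a : NR) (k : ℕ) (h : (nfH a).natDegree ≤ k) : (nfH (nfD a)).natDegree ≤ k + 1 := by
  rw [Polynomial.natDegree_le_iff_coeff_eq_zero]
  intro N hN
  obtain ⟨n, rfl⟩ : ∃ n, N = n + 1 := ⟨N - 1, by omega⟩
  rw [(nfH_D a).2, Polynomial.coeff_eq_zero_of_natDegree_lt (by omega), map_zero]

theorem nf_cross (F : Fin 3 → S) (e : ℕ) (hF : ∀ i, (F i).IsHomogeneous e)
    (hno : ∀ p, Prime p → (∀ i, p ∣ F i) → False) (j0 : Fin 3) (h0 : F j0 ≠ 0)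
    (A B : Fin 3 → NR) (k1 k2 : ℕ) (hk : k1 + k2 < e)
    (hA : ∑ i, A i * nfφ (F i) = 0) (hB : ∑ i, B i * nfφ (F i) = 0)
    (hA1 : ∀ i, (nfH (A i)).natDegree ≤ k1) (hB1 : ∀ i, (nfH (B i)).natDegree ≤ k2) :
    ∀ i j, B i * A j = B j * A i := by
  rw [Fin.sum_univ_three] at hA hB
  have hdeg : ∀ i j, (nfH (A i * B j - A j * B i)).natDegree ≤ k1 + k2 := by
    intro i j
    rw [map_sub, map_mul, map_mul]
    apply (Polynomial.natDegree_sub_le _ _).trans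
    apply max_le
    · exact Polynomial.natDegree_mul_le.trans (Nat.add_le_add (hA1 _) (hB1 _))
    · exact Polynomial.natDegree_mul_le.trans (Nat.add_le_add (hA1 _) (hB1 _))
  let P : Fin 3 → NR := ![A 1 * B 2 - A 2 * B 1, A 2 * B 0 - A 0 * B 2, A 0 * B 1 - A 1 * B 0]
  have hPd : ∀ i, (nfH (P i)).natDegree ≤ k1 + k2 := by
    intro i; fin_cases i
    · exact hdeg 1 2
    · exact hdeg 2 0
    · exact hdeg 0 1
  have hpar : ∀ i j, P i * nfφ (F j) = P j * nfφ (F i) := by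
    intro i j
    fin_cases i <;> fin_cases j <;> simp [P]
    · linear_combination B 2 * hA - A 2 * hB
    · linear_combination - B 1 * hA + A 1 * hB
    · linear_combination - B 2 * hA + A 2 * hB
    · linear_combination B 0 * hA - A 0 * hB
    · linear_combination B 1 * hA - A 1 * hB
    · linear_combination - B 0 * hA + A 0 * hB
  have hφ0 : nfφ (F j0) ≠ 0 := fun h => h0 (nfφ_inj (by rw [h, map_zero]))
  obtain ⟨g, hg⟩ := nf_vec (fun i => nfφ (F i)) P (nf_noprime F hno j0 h0) j0 hφ0 hpar
  have hg0 : g = 0 := by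
    by_contra hg0
    have h1 := hPd j0
    rw [hg, map_mul, nfH_φ _ e (hF j0), Polynomial.natDegree_mul (nfH_ne hg0)
      (mul_ne_zero (by simpa using hφ0) (pow_ne_zero _ Polynomial.X_ne_zero)),
      Polynomial.natDegree_mul (by simpa using hφ0) (pow_ne_zero _ Polynomial.X_ne_zero),
      Polynomial.natDegree_X_pow] at h1
    omega
  have q0 : A 1 * B 2 - A 2 * B 1 = 0 := by have := hg 0; simpa [P, hg0] using this
  have q1 : A 2 * B 0 - A 0 * B 2 = 0 := by have := hg 1; simpa [P, hg0] using this
  have q2 : A 0 * B 1 - A 1 * B 0 = 0 := by have := hg 2; simpa [P, hg0] using this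
  intro i j
  fin_cases i <;> fin_cases j <;> simp
  · linear_combination -q2
  · linear_combination q1
  · linear_combination q2
  · linear_combination -q0
  · linear_combination -q1
  · linear_combination q0

theorem nf_syz (F : Fin 3 → S) (e : ℕ) (hF : ∀ i, (F i).IsHomogeneous e)
    (hno : ∀ p, Prime p → (∀ i, p ∣ F i) → False) (j0 : Fin 3) (h0 : F j0 ≠ 0)
    (k : ℕ) (hk : 2 * k + 1 < e) : ∃ A : Fin 3 → S, ∑ i, A i * F i = 0 ∧
      ∀ B : Fin 3 → NR, ∑ i, B i * nfφ (F i) = 0 → (∀ i, (nfH (B i)).natDegree ≤ k) →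
        ∃ μ, ∀ i, B i = μ * nfφ (A i) := by
  by_cases hex : ∃ B : Fin 3 → NR, ∑ i, B i * nfφ (F i) = 0 ∧ (∀ i, (nfH (B i)).natDegree ≤ k) ∧
    ∃ i0, B i0 ≠ 0
  swap
  · push Not at hex
    refine ⟨0, by simp, fun B h1 h2 => ⟨0, fun i => ?_⟩⟩
    rw [hex B h1 h2 i]; simp
  obtain ⟨B, hB, hBd, i0, hi0⟩ := hex
  obtain ⟨g, A, hg, hBA, hprim⟩ := nf_prim B i0 hi0
  have hA : ∑ i, A i * nfφ (F i) = 0 := by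
    apply mul_left_cancel₀ hg
    rw [mul_zero, ← hB, Finset.mul_sum]
    exact Finset.sum_congr rfl fun i _ => by rw [hBA]; ring
  have hAd : ∀ i, (nfH (A i)).natDegree ≤ k := by
    intro i
    by_cases hi : A i = 0
    · simp [hi]
    have := hBd i
    rw [hBA, map_mul, Polynomial.natDegree_mul (nfH_ne hg) (nfH_ne hi)] at this
    omega
  have hAi0 : A i0 ≠ 0 := by
    intro h; apply hi0; rw [hBA, h, mul_zero]
  have hDA : ∑ i, nfD (A i) * nfφ (F i) = 0 := by
    have := congrArg nfD hA
    rw [map_sum, map_zero] at this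
    rw [← this]
    exact Finset.sum_congr rfl fun i _ => by rw [nfD_mul, nfD_φ]; ring
  obtain ⟨c, hc⟩ := nf_vec A (fun i => nfD (A i)) hprim i0 hAi0
    (nf_cross F e hF hno j0 h0 A (fun i => nfD (A i)) k (k+1) (by omega) hA hDA hAd
      (fun i => nfH_D_deg _ _ (hAd i)))
  have hker : ∀ i, ∃ b, A i = nfφ b := fun i => nf_ker _ (nfD_eigen _ _ (hc i))
  choose A' hA' using hker
  refine ⟨A', ?_, ?_⟩
  · apply nfφ_inj
    rw [map_sum, map_zero, ← hA]
    exact Finset.sum_congr rfl fun i _ => by rw [map_mul, hA']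
  · intro B' hB' hBd'
    simp only [← hA']
    exact nf_vec A B' hprim i0 hAi0
      (nf_cross F e hF hno j0 h0 A B' k k (by omega) hA hB' hAd hBd')

abbrev NP : Type := MvPolynomial (Fin 2) S
abbrev NQ : Type := MvPolynomial (Fin 2) ℂ

def nfL : NP := C (X 2) - X 0 * C (X 0) - X 1 * C (X 1)

theorem nfL_ne : nfL ≠ 0 := by
  intro h
  have := congrArg constantCoeff h
  simp [nfL] at this

def nfΨ : NP →+* NR := eval₂Hom (nfφ : S →+* NR) ![X 2, X 3]
theorem nfΨ_C (a : S) : nfΨ (C a) = nfφ a := by simp [nfΨ]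
theorem nfΨ_X0 : nfΨ (X 0) = X 2 := by simp [nfΨ]
theorem nfΨ_X1 : nfΨ (X 1) = X 3 := by simp [nfΨ]
theorem nfΨ_L : nfΨ nfL = 0 := by
  simp only [nfL, map_sub, map_mul, nfΨ_C, nfΨ_X0, nfΨ_X1, nfφ_X0, nfφ_X1, nfφ_X2]; ring

def nfΙ : NR →+* NP := eval₂Hom (C.comp C) ![C (X 0), C (X 1), X 0, X 1]

theorem nfΙ_Ψ (a : NP) : nfL ∣ a - nfΙ (nfΨ a) := by
  rw [← Ideal.mem_span_singleton, ← Ideal.Quotient.eq]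
  have : (Ideal.Quotient.mk (Ideal.span {nfL})) =
      ((Ideal.Quotient.mk (Ideal.span {nfL})).comp nfΙ).comp nfΨ := by
    apply MvPolynomial.ringHom_ext'
    · apply MvPolynomial.ringHom_ext
      · intro r
        simp [nfΨ_C, nfΙ]
      · intro i
        fin_cases i
        · simp [nfΨ_C, nfφ_X0, nfΙ]
        · simp [nfΨ_C, nfφ_X1, nfΙ]
        · simp only [Fin.reduceFinMk, RingHom.comp_apply, nfΨ_C, nfφ_X2]
          rw [Ideal.Quotient.eq, Ideal.mem_span_singleton]
          simp [nfΙ, nfL]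
          ring_nf
          exact dvd_rfl
    · intro i
      fin_cases i
      · simp [nfΨ_X0, nfΙ]
      · simp [nfΨ_X1, nfΙ]
  exact DFunLike.congr_fun this a

def nfΘ : NQ →+* NP := MvPolynomial.map C

theorem nfHΨΘ (c : NQ) : ∃ w, nfH (nfΨ (nfΘ c)) = Polynomial.C w := by
  induction c using MvPolynomial.induction_on with
  | C a => exact ⟨C a, by simp [nfΘ, nfΨ_C, nfH_C]⟩
  | add p q hp hq =>
    obtain ⟨v, hv⟩ := hp
    obtain ⟨w, hw⟩ := hq
    exact ⟨v + w, by simp only [map_add, hv, hw]⟩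
  | mul_X p i hp =>
    obtain ⟨v, hv⟩ := hp
    fin_cases i
    · exact ⟨v * X 2, by simp only [map_mul, hv]; simp [nfΘ, nfΨ_X0, nfH_X2]⟩
    · exact ⟨v * X 3, by simp only [map_mul, hv]; simp [nfΘ, nfΨ_X1, nfH_X3]⟩

theorem nf_ker_mat (a b : ℕ) (h : b < a) (M : Fin a → Fin b → NQ) :
    ∃ c : Fin a → NQ, (∃ i, c i ≠ 0) ∧ ∀ k, ∑ i, c i * M i k = 0 := by
  by_contra hc
  push Not at hc
  have hinj : Function.Injective (Matrix.vecMulLinear (Matrix.of M)) := by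
    rw [injective_iff_map_eq_zero]
    intro c h0
    by_contra hne
    obtain ⟨i, hi⟩ := Function.ne_iff.1 hne
    obtain ⟨k, hk⟩ := hc c ⟨i, hi⟩
    apply hk
    have := congrFun h0 k
    simpa [Matrix.vecMul, dotProduct] using this
  have := card_le_of_injective NQ _ hinj
  simp at this
  omega

/-- key step -/
theorem nf_core (f : S) (F : Fin 3 → S) (hFJ : Jf f = Ideal.span (Set.range F)) (e : ℕ)
    (hF : ∀ i, (F i).IsHomogeneous e)
    (hno : ∀ p, Prime p → (∀ i, p ∣ F i) → False) (j0 : Fin 3) (h0 : F j0 ≠ 0)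
    (q : ℕ) (hq : 2 * q + 1 < e) (a b : ℕ) (hab : b < a) (u : Fin a → S) (v : Fin b → S)
    (M : Fin 3 → Fin a → Fin b → ℂ) (A : Fin 3 → Fin a → Fin 3 → S)
    (hA : ∀ m i r, (A m i r).IsHomogeneous q)
    (heq : ∀ m i, X m * u i = ∑ k, C (M m i k) * v k + ∑ r, A m i r * F r) :
    ∃ c : Fin a → ℂ, (∃ i, c i ≠ 0) ∧ ∑ i, C (c i) * u i ∈ Jf f := by
  obtain ⟨At, hAt, hmu⟩ := nf_syz F e hF hno j0 h0 q hq
  obtain ⟨c, ⟨i1, hi1⟩, hc⟩ := nf_ker_mat a b hab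
    (fun i k => C (M 2 i k) - X 0 * C (M 0 i k) - X 1 * C (M 1 i k))
  let U : NP := ∑ i, nfΘ (c i) * C (u i)
  let W : Fin a → Fin 3 → NP := fun i r => C (A 2 i r) - X 0 * C (A 0 i r) - X 1 * C (A 1 i r)
  let AA : Fin 3 → NP := fun r => ∑ i, nfΘ (c i) * W i r
  have hLu : ∀ i, nfL * C (u i) = ∑ k, nfΘ (C (M 2 i k) - X 0 * C (M 0 i k) - X 1 * C (M 1 i k)) * C (v k)
      + ∑ r, W i r * C (F r) := by
    intro i
    have e1 : nfL * C (u i) = C (X 2 * u i) - X 0 * C (X 0 * u i) - X 1 * C (X 1 * u i) := by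
      simp only [nfL, map_mul]; ring
    rw [e1, heq 2, heq 0, heq 1]
    have hC : ∀ z : ℂ, nfΘ (C z) = C (C z) := fun z => by simp [nfΘ]
    have hX : ∀ i, nfΘ (X i) = X i := fun z => by simp [nfΘ]
    simp only [W, map_add, map_sum, map_mul, map_sub, hC, hX, sub_mul, Finset.sum_sub_distrib,
      Finset.mul_sum, mul_add, mul_assoc]
    ring
  have hLU : nfL * U = ∑ r, AA r * C (F r) := by
    calc nfL * U = ∑ i, nfΘ (c i) * (nfL * C (u i)) := by
          simp only [U, Finset.mul_sum]
          exact Finset.sum_congr rfl fun i _ => by ring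
      _ = ∑ i, ∑ k, nfΘ (c i * (C (M 2 i k) - X 0 * C (M 0 i k) - X 1 * C (M 1 i k))) * C (v k)
          + ∑ i, ∑ r, nfΘ (c i) * W i r * C (F r) := by
          rw [← Finset.sum_add_distrib]
          refine Finset.sum_congr rfl fun i _ => ?_
          rw [hLu, mul_add, Finset.mul_sum, Finset.mul_sum]
          simp only [map_mul, mul_assoc]
      _ = ∑ r, AA r * C (F r) := by
          rw [Finset.sum_comm, Finset.sum_comm (f := fun i r => nfΘ (c i) * W i r * C (F r))]
          simp only [← Finset.sum_mul, ← map_sum, hc, map_zero, zero_mul, Finset.sum_const_zero, zero_add, AA]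
  have hsyz : ∑ r, nfΨ (AA r) * nfφ (F r) = 0 := by
    have := congrArg nfΨ hLU
    rw [map_mul, nfΨ_L, zero_mul, map_sum] at this
    rw [this]
    exact Finset.sum_congr rfl fun i _ => by rw [map_mul, nfΨ_C]
  have hdeg : ∀ r, (nfH (nfΨ (AA r))).natDegree ≤ q := by
    intro r
    simp only [AA, map_sum]
    apply Polynomial.natDegree_sum_le_of_forall_le
    intro i _
    obtain ⟨w, hw⟩ := nfHΨΘ (c i)
    have : nfH (nfΨ (nfΘ (c i) * W i r)) =
        Polynomial.C (w * (nfφ (A 2 i r) - X 2 * nfφ (A 0 i r) - X 3 * nfφ (A 1 i r))) * Polynomial.X ^ q := by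
      simp only [map_mul, hw, W, map_sub, nfΨ_X0, nfΨ_X1, nfΨ_C, nfH_X2, nfH_X3, nfH_φ _ q (hA _ _ _)]
      ring
    rw [this]
    exact Polynomial.natDegree_C_mul_X_pow_le _ _
  obtain ⟨μ, hμ⟩ := hmu (fun r => nfΨ (AA r)) hsyz hdeg
  have hdec : ∀ r, ∃ B, AA r = nfΙ μ * C (At r) + nfL * B := by
    intro r
    obtain ⟨B1, h1⟩ := nfΙ_Ψ (AA r)
    obtain ⟨B2, h2⟩ := nfΙ_Ψ (C (At r))
    rw [hμ, map_mul] at h1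
    rw [nfΨ_C] at h2
    exact ⟨B1 - nfΙ μ * B2, by linear_combination h1 - nfΙ μ * h2⟩
  choose B hB using hdec
  have hU : U = ∑ r, B r * C (F r) := by
    apply mul_left_cancel₀ nfL_ne
    rw [hLU, Finset.mul_sum]
    have h3 : ∑ r, nfΙ μ * (C (At r * F r) : NP) = 0 := by
      rw [← Finset.mul_sum, ← map_sum, hAt, map_zero, mul_zero]
    rw [← add_zero (∑ r, nfL * (B r * C (F r))), ← h3, ← Finset.sum_add_distrib]
    exact Finset.sum_congr rfl fun r _ => by rw [hB, map_mul]; ring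
  have hUm : U ∈ Ideal.map (C : S →+* NP) (Jf f) := by
    rw [hU]
    refine Ideal.sum_mem _ fun r _ => Ideal.mul_mem_left _ _ (Ideal.mem_map_of_mem _ ?_)
    rw [hFJ]
    exact Ideal.subset_span ⟨r, rfl⟩
  rw [MvPolynomial.mem_map_C_iff] at hUm
  obtain ⟨m, hm⟩ := MvPolynomial.exists_coeff_ne_zero hi1
  refine ⟨fun i => coeff m (c i), ⟨i1, hm⟩, ?_⟩
  have := hUm m
  simp only [U, coeff_sum] at this
  convert this using 2 with i
  rw [mul_comm (nfΘ _), coeff_C_mul, nfΘ, coeff_map, mul_comm]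

theorem nf_unimodal (f : S) (e : ℕ)
    (hF : ∀ i, (pderiv i f).IsHomogeneous e)
    (hno : ∀ p, Prime p → (∀ i, p ∣ pderiv i f) → False) (j0 : Fin 3) (h0 : pderiv j0 f ≠ 0)
    (j : ℕ) (hj : 2 * j + 6 ≤ 3 * e) : ndim f j ≤ ndim f (j + 1) := by
  by_contra hlt
  push Not at hlt
  have hFJ : Jf f = Ideal.span (Set.range fun i => pderiv i f) := by
    rw [Jf]; congr 1
    ext u; simp [Fin.exists_fin_succ, eq_comm]
  have fin : ∀ k, Module.Finite ℂ (Nsub f k) := by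
    intro k
    have h1 : Module.Finite ℂ (Sgr k) := Module.Finite.iff_fg.2 (homogeneousSubmodule_fg _ _ _)
    have : Nsub f k ≤ (Sgr k).map (quotC f) := Submodule.map_mono inf_le_right
    have h2 : Module.Finite ℂ ((Sgr k).map (quotC f)) := inferInstance
    exact Submodule.finiteDimensional_of_le this
  have := fin j
  have := fin (j + 1)
  let b0 := Module.finBasis ℂ (Nsub f j)
  let b1 := Module.finBasis ℂ (Nsub f (j + 1))
  have hu : ∀ i, ∃ u, u ∈ Isat f ∧ u.IsHomogeneous j ∧ quotC f u = b0 i := by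
    intro i
    obtain ⟨u, ⟨h1, h2⟩, h3⟩ := (b0 i).2
    exact ⟨u, h1, h2, h3⟩
  have hv : ∀ i, ∃ u, u ∈ Isat f ∧ u.IsHomogeneous (j + 1) ∧ quotC f u = b1 i := by
    intro i
    obtain ⟨u, ⟨h1, h2⟩, h3⟩ := (b1 i).2
    exact ⟨u, h1, h2, h3⟩
  choose u hu1 hu2 hu3 using hu
  choose v hv1 hv2 hv3 using hv
  have hker : ∀ w, quotC f w = 0 ↔ w ∈ Jf f := fun w => Submodule.Quotient.mk_eq_zero _
  have hX : ∀ (m : Fin 3) i, X m * u i ∈ Isat f ∧ (X m * u i).IsHomogeneous (j + 1) := by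
    intro m i
    refine ⟨Ideal.mul_mem_left _ _ (hu1 i), ?_⟩
    rw [add_comm]
    exact (isHomogeneous_X _ _).mul (hu2 i)
  have hN : ∀ (m : Fin 3) i, quotC f (X m * u i) ∈ Nsub f (j + 1) := fun m i =>
    ⟨_, hX m i, rfl⟩
  let M : Fin 3 → Fin _ → Fin _ → ℂ := fun m i k => b1.repr ⟨_, hN m i⟩ k
  have hex : ∀ m i, ∃ A : Fin 3 → S, (∀ r, (A r).IsHomogeneous (j + 1 - e)) ∧
      X m * u i = ∑ k, C (M m i k) * v k + ∑ r, A r * pderiv r f := by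
    intro m i
    have hmem : X m * u i - ∑ k, C (M m i k) * v k ∈ Jf f := by
      rw [← hker, map_sub, map_sum, sub_eq_zero]
      have h1 := congrArg Subtype.val (b1.sum_repr ⟨_, hN m i⟩)
      simp only [Submodule.coe_sum, Submodule.coe_smul] at h1
      rw [← h1]
      refine Finset.sum_congr rfl fun k _ => ?_
      rw [← smul_eq_C_mul, map_smul, hv3]
    have hh : (X m * u i - ∑ k, C (M m i k) * v k).IsHomogeneous (j + 1) := by
      refine (hX m i).2.sub (IsHomogeneous.sum _ _ _ fun k _ => ?_)
      have := (isHomogeneous_C (Fin 3) (M m i k)).mul (hv2 k)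
      rwa [zero_add] at this
    have hmem := hFJ.le hmem
    obtain ⟨A, hA, hA1, hA2⟩ := nf_mem_span_hom (fun i => pderiv i f) e (j + 1) hF _ hmem
    rw [homogeneousComponent_of_mem hh, if_pos rfl] at hA
    refine ⟨A, ?_, by rw [← hA]; ring⟩
    intro r
    by_cases hje : e ≤ j + 1
    · exact hA1 hje r
    · rw [hA2 (by omega) r]; exact isHomogeneous_zero _ _ _
  choose A hA hAe using hex
  obtain ⟨c, ⟨i, hi⟩, hc⟩ := nf_core f (fun i => pderiv i f) hFJ e hF hno j0 h0 (j + 1 - e) (by omega)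
    _ _ hlt u v M A hA hAe
  apply hi
  have hli := Fintype.linearIndependent_iff.1 b0.linearIndependent c
  apply hli
  apply Subtype.ext
  rw [← hker, map_sum] at hc
  simp only [Submodule.coe_sum, Submodule.coe_smul, ZeroMemClass.coe_zero]
  rw [← hc]
  refine Finset.sum_congr rfl fun k _ => ?_
  rw [← smul_eq_C_mul, map_smul, hu3]

theorem nf_comb (n : ℕ → ℕ) (m' tot : ℕ) (hs : ∀ i, i ≤ 2 * (m' + 1) + 1 → n i = n (2 * (m' + 1) + 1 - i))
    (hz : ∀ i, 2 * (m' + 1) + 1 < i → n i = 0) (hm : ∀ i, i < m' + 1 → n i ≤ n (i + 1))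
    (ht : tot = ∑ i ∈ Finset.range (2 * (m' + 1) + 2), n i) (h0 : tot ≠ 0) :
    (n (m' + 1) = 1 ↔ ∀ k, n k ≤ 1) ∧ 2 ≤ tot ∧ (tot = 2 ↔ n (m' + 1) = 1 ∧ n m' = 0) := by
  have up : ∀ j, j ≤ m' + 1 → ∀ i, i ≤ j → n i ≤ n j := by
    intro j
    induction j with
    | zero => intro _ i hi; rw [Nat.le_zero.1 hi]
    | succ j ih =>
      intro hj i hi
      rcases Nat.lt_or_ge i (j + 1) with h | h
      · exact (ih (by omega) i (by omega)).trans (hm j (by omega))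
      · rw [show i = j + 1 by omega]
  have all : ∀ i, n i ≤ n (m' + 1) := by
    intro i
    rcases Nat.lt_or_ge (2 * (m' + 1) + 1) i with h | h
    · rw [hz i h]; omega
    rcases Nat.lt_or_ge (m' + 1) i with h1 | h1
    · rw [hs i h]; exact up _ le_rfl _ (by omega)
    · exact up _ le_rfl _ h1
  have htot : tot = 2 * (∑ i ∈ Finset.range m', n i + n m' + n (m' + 1)) := by
    rw [ht, show 2 * (m' + 1) + 2 = (m' + 2) + (m' + 2) by ring, Finset.sum_range_add]
    have : ∑ x ∈ Finset.range (m' + 2), n (m' + 2 + x) = ∑ x ∈ Finset.range (m' + 2), n x := by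
      rw [← Finset.sum_range_reflect]
      refine Finset.sum_congr rfl fun x hx => ?_
      rw [Finset.mem_range] at hx
      rw [hs x (by omega)]
      congr 1; omega
    rw [this, Finset.sum_range_succ, Finset.sum_range_succ]; ring
  have hn : n (m' + 1) ≠ 0 := by
    intro h
    apply h0
    rw [ht]
    exact Finset.sum_eq_zero fun i _ => by have := all i; omega
  refine ⟨⟨fun h k => h ▸ all k, fun h => ?_⟩, by omega, ?_, ?_⟩
  · have := h (m' + 1); omega
  · intro h; omega
  · rintro ⟨h1, h2⟩
    have : ∑ i ∈ Finset.range m', n i = 0 := Finset.sum_eq_zero fun i hi => by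
      rw [Finset.mem_range] at hi
      have := up m' (by omega) i (by omega)
      omega
    omega

theorem nf_Nsub_fin (f : S) (k : ℕ) : Module.Finite ℂ (Nsub f k) := by
  have h1 : Module.Finite ℂ (Sgr k) := Module.Finite.iff_fg.2 (homogeneousSubmodule_fg _ _ _)
  have : Nsub f k ≤ (Sgr k).map (quotC f) := Submodule.map_mono inf_le_right
  have h2 : Module.Finite ℂ ((Sgr k).map (quotC f)) := inferInstance
  exact Submodule.finiteDimensional_of_le this

theorem NFD.hcJ (D : NFD) (u : S) (i : ℕ) (h : u ∈ D.J) : homogeneousComponent i u ∈ D.J := by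
  have hr : Set.range ![D.g1, D.g2, D.h] = {D.g1, D.g2, D.h} := by
    ext x; simp; tauto
  have := nf_span_hc ![D.g1, D.g2, D.h] D.e i
    (by intro i; fin_cases i; exacts [D.hg1, D.hg2, D.hh]) u (by rw [hr]; exact h)
  rw [hr] at this; exact this

theorem NFD.hcI (D : NFD) (f : S) (hJ : Jf f = D.J) (u : S) (i : ℕ) (h : u ∈ Isat f) :
    homogeneousComponent i u ∈ Isat f := by
  rw [D.sat f hJ] at h ⊢
  obtain ⟨n, hn⟩ := h
  refine ⟨n, ?_⟩
  have h1 := D.hcJ _ (i + n) hn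
  have hl : (D.l ^ n).IsHomogeneous n := by have := D.hl.pow n; rwa [one_mul] at this
  rw [mul_comm, nf_hc_mul _ _ n _ hl, if_pos (by omega), Nat.add_sub_cancel] at h1
  rwa [mul_comm]

theorem NFD.total (D : NFD) (f : S) (hJ : Jf f = D.J) :
    ndimTot f = ∑ i ∈ Finset.range (3 * D.e - 3 + 1), ndim f i ∧ (ndimTot f = 0 → Nmod f = ⊥) := by
  have hker : ∀ w, quotC f w = 0 ↔ w ∈ Jf f := fun w => Submodule.Quotient.mk_eq_zero _
  have hfin := nf_Nsub_fin f
  let Φ : (∀ i : Fin (3 * D.e - 3 + 1), Nsub f i) →ₗ[ℂ] (S ⧸ (Jf f : Submodule S S)) :=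
    ∑ i : Fin (3 * D.e - 3 + 1), (Nsub f (i : ℕ)).subtype ∘ₗ LinearMap.proj i
  have hΦ : ∀ w, Φ w = ∑ i, (w i : S ⧸ (Jf f : Submodule S S)) := fun w => by simp [Φ]
  have hinj : Function.Injective Φ := by
    rw [injective_iff_map_eq_zero]
    intro w hw
    have hu : ∀ i, ∃ u, u.IsHomogeneous (i : ℕ) ∧ quotC f u = w i := by
      intro i
      obtain ⟨u, ⟨h1, h2⟩, h3⟩ := (w i).2
      exact ⟨u, h2, h3⟩
    choose u hu1 hu2 using hu
    rw [hΦ] at hw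
    simp only [← hu2, ← map_sum] at hw
    rw [hker, hJ] at hw
    funext k
    apply Subtype.ext
    rw [← hu2]
    change quotC f (u k) = 0
    rw [hker, hJ]
    have := D.hcJ _ k hw
    rw [map_sum, Finset.sum_eq_single k] at this
    · rwa [homogeneousComponent_of_mem (hu1 k), if_pos rfl] at this
    · intro i _ hik
      rw [homogeneousComponent_of_mem (hu1 i), if_neg (fun h => hik (Fin.ext h.symm))]
    · intro h; exact absurd (Finset.mem_univ _) h
  have hrange : LinearMap.range Φ = NsubTot f := by
    apply le_antisymm
    · rintro _ ⟨w, rfl⟩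
      rw [hΦ]
      refine Submodule.sum_mem _ fun i _ => ?_
      exact Submodule.map_mono inf_le_left (w i).2
    · rintro _ ⟨u, hu, rfl⟩
      rw [← sum_homogeneousComponent u, map_sum]
      refine Submodule.sum_mem _ fun i _ => ?_
      have hm : quotC f (homogeneousComponent i u) ∈ Nsub f i :=
        ⟨_, ⟨D.hcI f hJ u i hu, homogeneousComponent_isHomogeneous i u⟩, rfl⟩
      rcases Nat.lt_or_ge i (3 * D.e - 3 + 1) with h | h
      · refine ⟨Pi.single ⟨i, h⟩ ⟨_, hm⟩, ?_⟩
        rw [hΦ, Finset.sum_eq_single ⟨i, h⟩]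
        · rw [Pi.single_eq_same]
        · intro b _ hb
          rw [Pi.single_eq_of_ne hb]; rfl
        · intro h; exact absurd (Finset.mem_univ _) h
      · have h0 := D.ndim_zero f hJ i (by omega)
        rw [ndim, Submodule.finrank_eq_zero] at h0
        rw [h0, Submodule.mem_bot] at hm
        rw [hm]; exact Submodule.zero_mem _
  constructor
  · rw [ndimTot, ← hrange, LinearMap.finrank_range_of_inj hinj, Module.finrank_pi_fintype,
      ← Fin.sum_univ_eq_sum_range (fun i => ndim f i)]
    rfl
  · intro h
    have : Module.Finite ℂ (NsubTot f) := by rw [← hrange]; infer_instance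
    rw [ndimTot, Submodule.finrank_eq_zero] at h
    rw [eq_bot_iff]
    intro x hx
    have hx' : x ∈ NsubTot f := hx
    rw [h] at hx'
    exact hx'

theorem nf_main (f : S) (d : ℕ) (hhom : f.IsHomogeneous d) (hred : Squarefree f)
    (hodd : Odd d) (hnotfree : Nmod f ≠ ⊥) :
    (ndim f (3 * (d - 2) / 2) = 1 ↔ ∀ k : ℕ, ndim f k ≤ 1) ∧
    2 ≤ ndimTot f ∧
    (ndimTot f = 2 ↔
      ndim f (3 * (d - 2) / 2) = 1 ∧ ndim f (3 * (d - 2) / 2 - 1) = 0) := by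
  have hd : d ≠ 0 := by rintro rfl; simp at hodd
  have hF : ∀ i, (pderiv i f).IsHomogeneous (d - 1) := fun i => hhom.pderiv
  have hno := nf_reduced_coprime f d hd hhom hred
  have hj : ∃ j, pderiv j f ≠ 0 := by
    by_contra h
    push Not at h
    exact hno (X 0) (X_prime) (fun i => by rw [h i]; exact dvd_zero _)
  obtain ⟨j0, hj0⟩ := hj
  have hd1 : d ≠ 1 := by
    rintro rfl
    apply hnotfree
    have h1 : (pderiv j0 f).totalDegree = 0 := by
      exact (hF j0).totalDegree hj0
    rw [totalDegree_eq_zero_iff_eq_C] at h1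
    have hc : coeff 0 (pderiv j0 f) ≠ 0 := by
      intro h; rw [h, C_0] at h1; exact hj0 h1
    have hJ : Jf f = ⊤ := by
      apply Ideal.eq_top_of_isUnit_mem (x := pderiv j0 f)
      · apply Ideal.subset_span
        fin_cases j0 <;> simp
      · rw [h1]; exact (isUnit_iff_ne_zero.2 hc).map C
    rw [eq_bot_iff]
    rintro _ ⟨u, hu, rfl⟩
    rw [Submodule.mem_bot, Submodule.mkQ_apply, Submodule.Quotient.mk_eq_zero, hJ]
    exact Submodule.mem_top
  obtain ⟨t, ht⟩ := hodd
  obtain ⟨t, rfl⟩ : ∃ s, t = s + 1 := ⟨t - 1, by omega⟩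
  obtain ⟨g1, g2, h, hg1, hg2, hh, hspan, h0, hrel⟩ := nf_combo3 (fun i => pderiv i f) (d - 1) hF hno
  obtain ⟨D, he, rfl, rfl, rfl⟩ := nf_line g1 g2 h (d - 1) (by omega) hg1 hg2 hh h0 hrel
  have hJ : Jf f = D.J := hspan
  obtain ⟨htot, hbot⟩ := D.total f hJ
  have hT : 3 * D.e - 3 = 2 * (3 * t + 1) + 1 := by omega
  have key := nf_comb (ndim f) (3 * t) (ndimTot f)
    (fun i hi => by rw [← hT] at hi ⊢; exact D.ndim_symm f hJ i hi)
    (fun i hi => by rw [← hT] at hi; exact D.ndim_zero f hJ i hi)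
    (fun i hi => nf_unimodal f (d - 1) hF hno j0 hj0 i (by omega))
    (by rw [htot, hT]) (fun h => hnotfree (hbot h))
  rw [show 3 * (d - 2) / 2 = 3 * t + 1 by omega, Nat.add_sub_cancel]
  exact key

theorem stmt9 (f : S) (d : ℕ) (hhom : f.IsHomogeneous d) (hred : Squarefree f)
    (hnc : ¬ IsConeOfLines f) (hodd : Odd d) (hnotfree : Nmod f ≠ ⊥) :
    (ndim f (3 * (d - 2) / 2) = 1 ↔ ∀ k : ℕ, ndim f k ≤ 1) ∧
    2 ≤ ndimTot f ∧
    (ndimTot f = 2 ↔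
      ndim f (3 * (d - 2) / 2) = 1 ∧ ndim f (3 * (d - 2) / 2 - 1) = 0) := by
  exact nf_main f d hhom hred hodd hnotfree


end
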